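/- arXiv:1510.05070 — 2 statements merged into one kernel-verified Lean document; each statement's English description precedes it below -/
import Mathlib

section
/- Every graph on n vertices having no component isomorphic to K_1 (an isolated vertex) and no component isomorphic to K_2 (a single edge) is ⌊4n/3⌋-weighted-list-antimagic. -/
/-- The weighted vertex sum at `v`: the weight `ω v` plus the sum of the labels `f e`
over the edges `e` of `G` incident to `v`. -/
noncomputable def weightedSum {V : Type*} [Fintype V] (G : SimpleGraph V)
    (ω : V → ℝ) (f : Sym2 V → ℝ) (v : V) : ℝ :=
  ω v + ∑ e ∈ (G.incidenceSet v).toFinite.toFinset, f e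

open MvPolynomial in
/-- The pairing on polynomials that makes the monomials orthonormal. -/
noncomputable def coeffPairing (σ : Type*) :
    MvPolynomial σ ℝ →ₗ[ℝ] MvPolynomial σ ℝ →ₗ[ℝ] ℝ :=
  (basisMonomials σ ℝ).constr ℝ fun d => lcoeff ℝ d

namespace coeffPairing

open MvPolynomial

variable {σ : Type*}

theorem monomial_left (d : σ →₀ ℕ) (a : ℝ) (Q : MvPolynomial σ ℝ) :
    coeffPairing σ (monomial d a) Q = a * coeff d Q := by
  have h : monomial d a = a • basisMonomials σ ℝ d := by simp [smul_monomial]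
  rw [h, map_smul, coeffPairing, Module.Basis.constr_basis]
  simp

theorem eq_sum (P Q : MvPolynomial σ ℝ) :
    coeffPairing σ P Q = ∑ d ∈ P.support, coeff d P * coeff d Q := by
  conv_lhs => rw [P.as_sum]
  simp only [map_sum, LinearMap.sum_apply, monomial_left]

theorem X_mul_X_mul (i : σ) (P Q : MvPolynomial σ ℝ) :
    coeffPairing σ (X i * P) (X i * Q) = coeffPairing σ P Q := by
  induction P using MvPolynomial.induction_on' with
  | monomial d a =>
    rw [X, monomial_mul, monomial_left, monomial_left, ← X, coeff_X_mul, one_mul]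
  | add p q hp hq => simp only [mul_add, map_add, LinearMap.add_apply, hp, hq]

theorem sub_mul_left (i j : σ) (P Q : MvPolynomial σ ℝ) :
    coeffPairing σ ((X i - X j) * P) (X i * X j * Q) =
      - coeffPairing σ P ((X i - X j) * Q) := by
  rw [sub_mul, sub_mul, map_sub, map_sub, LinearMap.sub_apply,
    show (X i * X j * Q : MvPolynomial σ ℝ) = X i * (X j * Q) by ring, X_mul_X_mul,
    show (X i * (X j * Q) : MvPolynomial σ ℝ) = X j * (X i * Q) by ring, X_mul_X_mul]
  ring

theorem self_pos {P : MvPolynomial σ ℝ} (hP : P ≠ 0) : 0 < coeffPairing σ P P := by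
  rw [eq_sum]
  refine Finset.sum_pos (fun d hd => ?_) (by simpa [Finset.nonempty_iff_ne_empty] using hP)
  exact mul_self_pos.2 (mem_support_iff.1 hd)

theorem pow_five_mul_left (i j : σ) (P Q : MvPolynomial σ ℝ) :
    coeffPairing σ ((X i - X j) ^ 5 * P) ((X i * X j) ^ 2 * (X i - X j) * Q) =
      coeffPairing σ ((X i - X j) ^ 3 * P) ((X i - X j) ^ 3 * Q) := by
  rw [show ((X i - X j) ^ 5 * P : MvPolynomial σ ℝ) =
      (X i - X j) * ((X i - X j) * ((X i - X j) ^ 3 * P)) by ring,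
    show ((X i * X j) ^ 2 * (X i - X j) * Q : MvPolynomial σ ℝ) =
      X i * X j * (X i * X j * ((X i - X j) * Q)) by ring, sub_mul_left,
    show ((X i - X j) * (X i * X j * ((X i - X j) * Q)) : MvPolynomial σ ℝ) =
      X i * X j * ((X i - X j) ^ 2 * Q) by ring, sub_mul_left, neg_neg]
  congr 1
  ring

theorem prod_pow_five_mul_left (s : Finset (σ × σ)) (P Q : MvPolynomial σ ℝ) :
    coeffPairing σ ((∏ p ∈ s, (X p.1 - X p.2) ^ 5) * P)
        ((∏ p ∈ s, (X p.1 * X p.2) ^ 2 * (X p.1 - X p.2)) * Q) =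
      coeffPairing σ ((∏ p ∈ s, (X p.1 - X p.2) ^ 3) * P)
        ((∏ p ∈ s, (X p.1 - X p.2) ^ 3) * Q) := by
  classical
  induction s using Finset.induction_on generalizing P Q with
  | empty => simp
  | insert p s hp ih =>
    have h (A B C : MvPolynomial σ ℝ) : A * B * C = B * (A * C) := by ring
    simp only [Finset.prod_insert hp, h, ih]
    simp only [mul_left_comm (∏ p ∈ s, _)]
    rw [← mul_assoc ((X p.1 * X p.2) ^ 2)]
    exact pow_five_mul_left _ _ _ _

end coeffPairing

section

open MvPolynomial

variable {ι : Type*} [Fintype ι] [LinearOrder ι]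

theorem card_filter_lt_mem_pair (k : ι) :
    ((Finset.univ.filter fun p : ι × ι => p.1 < p.2).filter
      fun p => p.1 = k ∨ p.2 = k).card ≤ Fintype.card ι - 1 := by
  have h : ((Finset.univ.filter fun p : ι × ι => p.1 < p.2).filter
      fun p => p.1 = k ∨ p.2 = k) ⊆
      (Finset.univ.erase k).image fun j => if j < k then (j, k) else (k, j) := by
    rintro ⟨a, b⟩ h
    simp only [Finset.mem_filter, Finset.mem_univ, true_and] at h
    obtain ⟨hab, rfl | rfl⟩ := h
    · exact Finset.mem_image.2 ⟨b, by simp [hab.ne'], by simp [hab.le]⟩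
    · exact Finset.mem_image.2 ⟨a, by simp [hab.ne], by simp [hab]⟩
  calc _ ≤ _ := Finset.card_le_card h
    _ ≤ _ := Finset.card_image_le
    _ = _ := by simp [Finset.card_univ]

/-- The fifth power of the Vandermonde product has a monomial with small exponents. -/
theorem exists_coeff_prod_sub_pow_five_ne_zero :
    ∃ d : ι →₀ ℕ, (∀ i, d i ≤ 3 * (Fintype.card ι - 1)) ∧
      coeff d (∏ p : ι × ι with p.1 < p.2, (X p.1 - X p.2 : MvPolynomial ι ℝ) ^ 5) ≠ 0 := by
  set s := Finset.univ.filter fun p : ι × ι => p.1 < p.2 with hs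
  have hne : (∏ p ∈ s, (X p.1 - X p.2 : MvPolynomial ι ℝ) ^ 3) ≠ 0 := by
    refine Finset.prod_ne_zero_iff.2 fun p hp => pow_ne_zero _ (sub_ne_zero.2 fun h => ?_)
    exact (Finset.mem_filter.1 hp).2.ne (X_injective h)
  have h := coeffPairing.self_pos hne
  have h' := coeffPairing.prod_pow_five_mul_left s 1 1
  simp only [mul_one] at h'
  rw [← h', coeffPairing.eq_sum] at h
  obtain ⟨d, -, hd⟩ := Finset.exists_ne_zero_of_sum_ne_zero h.ne'
  refine ⟨d, fun k => ?_, left_ne_zero_of_mul hd⟩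
  have hk := (monomial_le_degreeOf k (mem_support_iff.2 (right_ne_zero_of_mul hd))).trans
    (degreeOf_prod_le k s _)
  refine hk.trans ?_
  calc _ ≤ ∑ p ∈ s, if p.1 = k ∨ p.2 = k then 3 else 0 := by
        refine Finset.sum_le_sum fun p hp => ?_
        have hlt : p.1 ≠ p.2 := (Finset.mem_filter.1 hp).2.ne
        have h1 := degreeOf_mul_le k ((X p.1 * X p.2 : MvPolynomial ι ℝ) ^ 2) (X p.1 - X p.2)
        have h2 := degreeOf_pow_le k (X p.1 * X p.2 : MvPolynomial ι ℝ) 2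
        have h3 := degreeOf_mul_le k (X p.1 : MvPolynomial ι ℝ) (X p.2)
        have h4 := degreeOf_sub_le k (X p.1 : MvPolynomial ι ℝ) (X p.2)
        simp only [degreeOf_X] at h3 h4
        split_ifs at * <;> simp_all <;> omega
    _ = 3 * (s.filter fun p => p.1 = k ∨ p.2 = k).card := by
        rw [← Finset.sum_filter, Finset.sum_const, smul_eq_mul, mul_comm]
    _ ≤ _ := Nat.mul_le_mul_left _ (card_filter_lt_mem_pair k)

end

open MvPolynomial in
theorem coeff_prod_sub_sub_C {ι κ : Type*} (s : Finset κ) (a b : κ → ι) (c : κ → ℝ)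
    (d : ι →₀ ℕ) (hd : s.card ≤ d.degree) :
    coeff d (∏ k ∈ s, (X (a k) - X (b k) - C (c k))) =
      coeff d (∏ k ∈ s, (X (a k) - X (b k) : MvPolynomial ι ℝ)) := by
  classical
  induction s using Finset.induction_on generalizing d with
  | empty => simp
  | insert k s hk ih =>
    rw [Finset.card_insert_of_notMem hk] at hd
    have hX (i : ι) : coeff d (X i * ∏ k ∈ s, (X (a k) - X (b k) - C (c k))) =
        coeff d (X i * ∏ k ∈ s, (X (a k) - X (b k) : MvPolynomial ι ℝ)) := by
      rw [coeff_X_mul', coeff_X_mul']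
      split_ifs with hi
      · apply ih
        have := congrArg Finsupp.degree
          (tsub_add_cancel_of_le (Finsupp.single_le_iff.2
            (Nat.one_le_iff_ne_zero.2 (Finsupp.mem_support_iff.1 hi))))
        rw [map_add, Finsupp.degree_single] at this
        omega
      · rfl
    have h0 : coeff d (∏ k ∈ s, (X (a k) - X (b k) - C (c k) : MvPolynomial ι ℝ)) = 0 := by
      apply coeff_eq_zero_of_totalDegree_lt
      refine ((totalDegree_finsetProd _ _).trans (?_ : _ ≤ s.card)).trans_lt
        (by rw [← Finsupp.degree_apply]; omega)
      refine (Finset.sum_le_card_nsmul _ _ 1 fun k _ => ?_).trans (by simp)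
      refine (totalDegree_sub_C_le _ _).trans ((totalDegree_sub _ _).trans ?_)
      simp
    rw [Finset.prod_insert hk, Finset.prod_insert hk, sub_mul, sub_mul, sub_mul, coeff_sub,
      coeff_sub, coeff_sub, coeff_C_mul, h0, hX, hX, mul_zero, sub_zero]

open MvPolynomial in
/-- From lists of size more than `3 * (#ι - 1)` one can choose representatives such that each
pairwise difference avoids five prescribed values. -/
theorem exists_mem_sub_ne {ι κ : Type*} [Fintype ι] [LinearOrder ι] [Fintype κ]
    (hκ : Fintype.card κ = 5) (L : ι → Finset ℝ)
    (hL : ∀ i, 3 * (Fintype.card ι - 1) < (L i).card) (c : ι → ι → κ → ℝ) :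
    ∃ y : ι → ℝ, (∀ i, y i ∈ L i) ∧ ∀ i j, i < j → ∀ k, y i - y j ≠ c i j k := by
  obtain ⟨d, hd, hc⟩ := exists_coeff_prod_sub_pow_five_ne_zero (ι := ι)
  set s := (Finset.univ.filter fun p : ι × ι => p.1 < p.2) ×ˢ (Finset.univ : Finset κ)
  set F : MvPolynomial ι ℝ := ∏ q ∈ s, (X q.1.1 - X q.1.2 - C (c q.1.1 q.1.2 q.2)) with hF
  have hpow : (∏ p : ι × ι with p.1 < p.2, (X p.1 - X p.2 : MvPolynomial ι ℝ) ^ 5) =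
      ∏ q ∈ s, (X q.1.1 - X q.1.2) := by
    rw [Finset.prod_product]
    simp [hκ]
  rw [hpow] at hc
  have hhom : (∏ q ∈ s, (X q.1.1 - X q.1.2 : MvPolynomial ι ℝ)).IsHomogeneous s.card := by
    have := IsHomogeneous.prod s (fun q => (X q.1.1 - X q.1.2 : MvPolynomial ι ℝ)) (fun _ => 1)
      fun q _ => (isHomogeneous_X _ _).sub (isHomogeneous_X _ _)
    simpa using this
  have hdeg : d.degree = s.card := by
    rw [Finsupp.degree_eq_weight_one]
    exact hhom hc
  have hF0 : coeff d F ≠ 0 := by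
    rwa [hF, coeff_prod_sub_sub_C s _ _ _ d hdeg.ge]
  have hle : F.totalDegree ≤ d.degree := by
    rw [hdeg]
    refine (totalDegree_finsetProd _ _).trans ?_
    refine (Finset.sum_le_card_nsmul _ _ 1 fun q _ => ?_).trans (by simp)
    refine (totalDegree_sub_C_le _ _).trans ((totalDegree_sub _ _).trans ?_)
    simp
  obtain ⟨y, hy, hy'⟩ := combinatorial_nullstellensatz_exists_eval_nonzero F d hF0
    (le_antisymm hle (le_totalDegree (mem_support_iff.2 hF0))) L
    fun i => (hd i).trans_lt (hL i)
  refine ⟨y, hy, fun i j hij k h => hy' ?_⟩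
  rw [hF, map_prod]
  refine Finset.prod_eq_zero (i := ((i, j), k)) (by simp [s, hij]) ?_
  simp [h]

/-- Three real numbers can be chosen from large sets so that their sum avoids a given set and
the numbers pairwise differ, with pairwise differences and sums avoiding given values. -/
theorem exists_triple_sum_notMem {X Y Z P : Finset ℝ} {N : ℕ} (hX : N ≤ X.card)
    (hY : N ≤ Y.card) (hZ : N ≤ Z.card) (hN : 7 ≤ N) (hP : P.card + 20 < 3 * N)
    (d₁ d₂ d₃ e₁ e₂ e₃ : ℝ) :
    ∃ x ∈ X, ∃ y ∈ Y, ∃ z ∈ Z, x + y + z ∉ P ∧ (x ≠ y ∧ x - y ≠ d₁ ∧ x + y ≠ e₁) ∧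
      (x ≠ z ∧ x - z ≠ d₂ ∧ x + z ≠ e₂) ∧ (y ≠ z ∧ y - z ≠ d₃ ∧ y + z ≠ e₃) := by
  have hcard (A : Finset ℝ) (a b c : ℝ) : A.card ≤ (A \ {a, b, c}).card + 3 := by
    have := Finset.le_card_sdiff {a, b, c} A
    have := Finset.card_le_three (a := a) (b := b) (c := c)
    omega
  have hl {x y d e : ℝ} (h : x ∉ ({y, d + y, e - y} : Finset ℝ)) :
      x ≠ y ∧ x - y ≠ d ∧ x + y ≠ e := by
    simp only [Finset.mem_insert, Finset.mem_singleton, not_or] at h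
    exact ⟨h.1, fun h' => h.2.1 (by linarith), fun h' => h.2.2 (by linarith)⟩
  have hr {x y d e : ℝ} (h : y ∉ ({x, x - d, e - x} : Finset ℝ)) :
      x ≠ y ∧ x - y ≠ d ∧ x + y ≠ e := by
    simp only [Finset.mem_insert, Finset.mem_singleton, not_or] at h
    exact ⟨Ne.symm h.1, fun h' => h.2.1 (by linarith), fun h' => h.2.2 (by linarith)⟩
  have hr' {x y d e : ℝ} (h : x ≠ y ∧ x - y ≠ d ∧ x + y ≠ e) :
      y ∉ ({x, x - d, e - x} : Finset ℝ) := by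
    simp only [Finset.mem_insert, Finset.mem_singleton, not_or]
    exact ⟨Ne.symm h.1, fun h' => h.2.1 (by linarith), fun h' => h.2.2 (by linarith)⟩
  by_contra! hcon
  -- a chain of admissible triples with increasing sums: first move `x`, then `y`, then `z`
  have hZne : Z.Nonempty := Finset.card_pos.1 (by omega)
  set z₀ := Z.min' hZne
  set Y₁ := Y \ {z₀, d₃ + z₀, e₃ - z₀} with hY₁
  have hY₁c := hcard Y z₀ (d₃ + z₀) (e₃ - z₀)
  rw [← hY₁] at hY₁c
  have hY₁ne : Y₁.Nonempty := Finset.card_pos.1 (by omega)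
  set y₀ := Y₁.min' hY₁ne
  set X₁ := (X \ {z₀, d₂ + z₀, e₂ - z₀}) \ {y₀, d₁ + y₀, e₁ - y₀} with hX₁
  have hX₁c := hcard X z₀ (d₂ + z₀) (e₂ - z₀)
  have hX₁c' := hcard (X \ {z₀, d₂ + z₀, e₂ - z₀}) y₀ (d₁ + y₀) (e₁ - y₀)
  rw [← hX₁] at hX₁c'
  have hX₁ne : X₁.Nonempty := Finset.card_pos.1 (by omega)
  set x₁ := X₁.max' hX₁ne
  have hx₁ : x₁ ∈ X₁ := Finset.max'_mem _ _
  have hy₀ : y₀ ∈ Y₁ := Finset.min'_mem _ _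
  have hz₀ : z₀ ∈ Z := Finset.min'_mem _ _
  set Y₂ := Y₁ \ {x₁, x₁ - d₁, e₁ - x₁} with hY₂
  have hY₂c := hcard Y₁ x₁ (x₁ - d₁) (e₁ - x₁)
  rw [← hY₂] at hY₂c
  have hX₁m {x : ℝ} (h : x ∈ X₁) : x ∈ X ∧ (x ≠ z₀ ∧ x - z₀ ≠ d₂ ∧ x + z₀ ≠ e₂) ∧
      (x ≠ y₀ ∧ x - y₀ ≠ d₁ ∧ x + y₀ ≠ e₁) := by
    rw [hX₁, Finset.mem_sdiff, Finset.mem_sdiff] at h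
    exact ⟨h.1.1, hl h.1.2, hl h.2⟩
  have hY₁m {y : ℝ} (h : y ∈ Y₁) : y ∈ Y ∧ (y ≠ z₀ ∧ y - z₀ ≠ d₃ ∧ y + z₀ ≠ e₃) := by
    rw [hY₁, Finset.mem_sdiff] at h
    exact ⟨h.1, hl h.2⟩
  have hY₂m {y : ℝ} (h : y ∈ Y₂) : y ∈ Y₁ ∧ (x₁ ≠ y ∧ x₁ - y ≠ d₁ ∧ x₁ + y ≠ e₁) := by
    rw [hY₂, Finset.mem_sdiff] at h
    exact ⟨h.1, hr h.2⟩
  have hy₀₂ : y₀ ∈ Y₂ := Finset.mem_sdiff.2 ⟨hy₀, hr' (hX₁m hx₁).2.2⟩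
  set y₂ := Y₂.max' ⟨_, hy₀₂⟩
  have hy₂ : y₂ ∈ Y₂ := Finset.max'_mem _ _
  set Z₂ := (Z \ {x₁, x₁ - d₂, e₂ - x₁}) \ {y₂, y₂ - d₃, e₃ - y₂} with hZ₂
  have hZ₂c := hcard Z x₁ (x₁ - d₂) (e₂ - x₁)
  have hZ₂c' := hcard (Z \ {x₁, x₁ - d₂, e₂ - x₁}) y₂ (y₂ - d₃) (e₃ - y₂)
  rw [← hZ₂] at hZ₂c'
  have hZ₂m {z : ℝ} (h : z ∈ Z₂) : z ∈ Z ∧ (x₁ ≠ z ∧ x₁ - z ≠ d₂ ∧ x₁ + z ≠ e₂) ∧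
      (y₂ ≠ z ∧ y₂ - z ≠ d₃ ∧ y₂ + z ≠ e₃) := by
    rw [hZ₂, Finset.mem_sdiff, Finset.mem_sdiff] at h
    exact ⟨h.1.1, hr h.1.2, hr h.2⟩
  set A := X₁.image fun x => x + y₀ + z₀ with hA
  set B := (Y₂.erase y₀).image fun y => x₁ + y + z₀ with hB
  set C := (Z₂.erase z₀).image fun z => x₁ + y₂ + z with hC
  have hAc : A.card = X₁.card := Finset.card_image_of_injective _ fun a b h => by simpa using h
  have hBc : B.card = (Y₂.erase y₀).card :=
    Finset.card_image_of_injective _ fun a b h => by simpa using h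
  have hCc : C.card = (Z₂.erase z₀).card :=
    Finset.card_image_of_injective _ fun a b h => by simpa using h
  have hBc' := Finset.pred_card_le_card_erase (s := Y₂) (a := y₀)
  have hCc' := Finset.pred_card_le_card_erase (s := Z₂) (a := z₀)
  have hAle : ∀ a ∈ A, a ≤ x₁ + y₀ + z₀ := by
    intro a ha
    obtain ⟨x, hx, rfl⟩ := Finset.mem_image.1 ha
    have := Finset.le_max' X₁ x hx
    simp only [x₁]
    linarith
  have hBl : ∀ b ∈ B, x₁ + y₀ + z₀ < b ∧ b ≤ x₁ + y₂ + z₀ := by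
    intro b hb
    obtain ⟨y, hy, rfl⟩ := Finset.mem_image.1 hb
    rw [Finset.mem_erase] at hy
    have h₁ : y ≤ y₂ := Finset.le_max' Y₂ y hy.2
    have h₂ : y₀ ≤ y := Finset.min'_le Y₁ y (hY₂m hy.2).1
    have h₃ := lt_of_le_of_ne h₂ hy.1.symm
    constructor <;> linarith
  have hCl : ∀ b ∈ C, x₁ + y₂ + z₀ < b := by
    intro b hb
    obtain ⟨z, hz, rfl⟩ := Finset.mem_image.1 hb
    rw [Finset.mem_erase] at hz
    have h₂ : z₀ ≤ z := Finset.min'_le Z z (hZ₂m hz.2).1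
    have h₃ := lt_of_le_of_ne h₂ hz.1.symm
    linarith
  have hy₀₂' : x₁ + y₀ + z₀ ≤ x₁ + y₂ + z₀ := by
    have : y₀ ≤ y₂ := Finset.le_max' Y₂ y₀ hy₀₂
    linarith
  have hAB : Disjoint A B := Finset.disjoint_left.2 fun a ha hb =>
    (hAle a ha).not_gt (hBl a hb).1
  have hABC : Disjoint (A ∪ B) C := Finset.disjoint_left.2 fun a ha hc => by
    have := hCl a hc
    rcases Finset.mem_union.1 ha with h | h
    · linarith [hAle a h]
    · linarith [(hBl a h).2]
  have hsub : (A ∪ B) ∪ C ⊆ P := by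
    intro a ha
    by_contra hP
    rcases Finset.mem_union.1 ha with h | h
    · rcases Finset.mem_union.1 h with h | h
      · obtain ⟨x, hx, rfl⟩ := Finset.mem_image.1 h
        have hx := hX₁m hx
        have hy := hY₁m hy₀
        exact hy.2.2.2 (hcon x hx.1 y₀ hy.1 z₀ hz₀ hP hx.2.2 hx.2.1 hy.2.1 hy.2.2.1)
      · obtain ⟨y, hy, rfl⟩ := Finset.mem_image.1 h
        have hx := hX₁m hx₁
        have hy := hY₂m (Finset.mem_erase.1 hy).2
        have hy' := hY₁m hy.1
        exact hy'.2.2.2 (hcon x₁ hx.1 y hy'.1 z₀ hz₀ hP hy.2 hx.2.1 hy'.2.1 hy'.2.2.1)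
    · obtain ⟨z, hz, rfl⟩ := Finset.mem_image.1 h
      have hx := hX₁m hx₁
      have hy := hY₂m hy₂
      have hy' := hY₁m hy.1
      have hz := hZ₂m (Finset.mem_erase.1 hz).2
      exact hz.2.2.2.2 (hcon x₁ hx.1 y₂ hy'.1 z hz.1 hP hy.2 hz.2.1 hz.2.2.1 hz.2.2.2.1)
  have hfin := Finset.card_le_card hsub
  rw [Finset.card_union_of_disjoint hABC, Finset.card_union_of_disjoint hAB] at hfin
  omega

section

open scoped Classical

variable {V : Type*}

/-- A finite set of loopless edges covering all vertices contains a spanning star forest, given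
by its set of leaves and the map sending each leaf to the centre of its star. -/
theorem exists_star_cover [Fintype V] (E : Finset (Sym2 V)) (hE : ∀ v, s(v, v) ∉ E)
    (hcov : ∀ v, ∃ e ∈ E, v ∈ e) :
    ∃ (S : Finset V) (φ : V → V), (∀ l ∈ S, φ l ∉ S ∧ s(l, φ l) ∈ E) ∧
      ∀ v, v ∈ S ∨ ∃ l ∈ S, φ l = v := by
  obtain ⟨F, hF, hmin⟩ := Finset.exists_min_image
    (E.powerset.filter fun F => ∀ v, ∃ e ∈ F, v ∈ e) Finset.card ⟨E, by simpa using hcov⟩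
  simp only [Finset.mem_filter, Finset.mem_powerset] at hF hmin
  have hleaf : ∀ e ∈ F, ∃ v ∈ e, ∀ e' ∈ F, v ∈ e' → e' = e := by
    intro e he
    by_contra! h
    refine (Finset.card_erase_lt_of_mem he).not_ge
      (hmin _ ⟨(Finset.erase_subset _ _).trans hF.1, fun v => ?_⟩)
    by_cases hv : v ∈ e
    · obtain ⟨e', he', hv', hne⟩ := h v hv
      exact ⟨e', Finset.mem_erase.2 ⟨hne, he'⟩, hv'⟩
    · obtain ⟨e', he', hv'⟩ := hF.2 v
      exact ⟨e', Finset.mem_erase.2 ⟨fun h => hv (h ▸ hv'), he'⟩, hv'⟩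
  choose ℓ hℓ hℓ' using hleaf
  set S : Finset V := Finset.univ.filter fun v => ∃ e, ∃ he : e ∈ F, ℓ e he = v with hS
  have hφ : ∀ v, ∃ w, v ∈ S → ∃ h : s(v, w) ∈ F, ℓ _ h = v := by
    intro v
    by_cases hv : v ∈ S
    · obtain ⟨e, he, rfl⟩ := (Finset.mem_filter.1 hv).2
      obtain ⟨w, hw⟩ := Sym2.mem_iff_exists.1 (hℓ e he)
      refine ⟨w, fun _ => ⟨hw ▸ he, ?_⟩⟩
      congr 1
      exact hw.symm
    · exact ⟨v, fun h => absurd h hv⟩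
  choose φ hφ using hφ
  refine ⟨S, φ, fun l hl => ⟨fun hl' => ?_, hF.1 (hφ l hl).1⟩, fun v => ?_⟩
  · obtain ⟨e, he, hel⟩ := (Finset.mem_filter.1 hl').2
    obtain ⟨h₁, h₂⟩ := hφ l hl
    have h := hℓ' e he _ h₁ (by simp [hel])
    subst h
    have : φ l = l := hel.symm.trans h₂
    rw [this] at h₁
    exact hE l (hF.1 h₁)
  · obtain ⟨e, he, hv⟩ := hF.2 v
    have hlS : ℓ e he ∈ S := Finset.mem_filter.2 ⟨Finset.mem_univ _, e, he, rfl⟩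
    obtain ⟨h₁, h₂⟩ := hφ _ hlS
    have h := hℓ' e he _ h₁ (by simp)
    rw [← h, Sym2.mem_iff] at hv
    rcases hv with hv | hv
    · exact Or.inl (hv ▸ hlS)
    · exact Or.inr ⟨_, hlS, hv.symm⟩

/-- Removing one leaf from each star with two leaves. -/
theorem exists_star_forest [Fintype V] (E : Finset (Sym2 V)) (hE : ∀ v, s(v, v) ∉ E)
    (hcov : ∀ v, ∃ e ∈ E, v ∈ e) :
    ∃ (S : Finset V) (φ : V → V), (∀ l ∈ S, φ l ∉ S ∧ s(l, φ l) ∈ E) ∧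
      (∀ l ∈ S, (S.filter fun l' => φ l' = φ l).card ≠ 2) ∧
      (Finset.univ.filter fun v => v ∉ S ∧ ∀ l ∈ S, φ l ≠ v).card ≤
        (S.filter fun l => (S.filter fun l' => φ l' = φ l).card = 1).card := by
  obtain ⟨S, φ, hS, hcover⟩ := exists_star_cover E hE hcov
  set P := Finset.univ.filter fun c => (S.filter fun l => φ l = c).card = 2 with hP
  have hr : ∀ c, ∃ l, c ∈ P → l ∈ S ∧ φ l = c := by
    intro c
    by_cases hc : c ∈ P
    · have hpos : 0 < (S.filter fun l => φ l = c).card := by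
        rw [(Finset.mem_filter.1 hc).2]; norm_num
      obtain ⟨l, hl⟩ := Finset.card_pos.1 hpos
      exact ⟨l, fun _ => Finset.mem_filter.1 hl⟩
    · exact ⟨c, fun h => absurd h hc⟩
  choose r hr using hr
  set S' := S \ P.image r with hS'
  have hsub : S' ⊆ S := Finset.sdiff_subset
  have hfibre : ∀ c ∈ P, (S'.filter fun l => φ l = c).card = 1 := by
    intro c hc
    have h : S'.filter (fun l => φ l = c) = (S.filter fun l => φ l = c).erase (r c) := by
      ext l
      simp only [hS', Finset.mem_filter, Finset.mem_sdiff, Finset.mem_image, Finset.mem_erase]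
      constructor
      · rintro ⟨⟨hl, hl'⟩, rfl⟩
        exact ⟨fun h => hl' ⟨_, hc, h.symm⟩, hl, rfl⟩
      · rintro ⟨hl, hl', rfl⟩
        refine ⟨⟨hl', ?_⟩, rfl⟩
        rintro ⟨c', hc', rfl⟩
        exact hl (by rw [(hr c' hc').2])
    rw [h, Finset.card_erase_of_mem (Finset.mem_filter.2 (hr c hc)), (Finset.mem_filter.1 hc).2]
  have hfibre' : ∀ c ∉ P, S'.filter (fun l => φ l = c) = S.filter fun l => φ l = c := by
    intro c hc
    ext l
    simp only [hS', Finset.mem_filter, Finset.mem_sdiff, Finset.mem_image]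
    constructor
    · rintro ⟨⟨hl, -⟩, rfl⟩
      exact ⟨hl, rfl⟩
    · rintro ⟨hl, rfl⟩
      refine ⟨⟨hl, ?_⟩, rfl⟩
      rintro ⟨c', hc', rfl⟩
      exact hc (by rw [(hr c' hc').2]; exact hc')
  have hPc : P.card ≤
      (S'.filter fun l => (S'.filter fun l' => φ l' = φ l).card = 1).card := by
    refine (Finset.card_le_card (t := Finset.image φ _) fun c hc => ?_).trans
      Finset.card_image_le
    have h := hfibre c hc
    obtain ⟨l, hl⟩ := Finset.card_pos.1 (h ▸ Nat.one_pos)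
    obtain ⟨hlS, rfl⟩ := Finset.mem_filter.1 hl
    exact Finset.mem_image.2 ⟨l, Finset.mem_filter.2 ⟨hlS, h⟩, rfl⟩
  refine ⟨S', φ, fun l hl => ⟨fun h => (hS l (hsub hl)).1 (hsub h), (hS l (hsub hl)).2⟩,
    fun l hl => ?_, le_trans ?_ hPc⟩
  · by_cases hc : φ l ∈ P
    · rw [hfibre _ hc]
      norm_num
    · rw [hfibre' _ hc]
      exact fun h => hc (Finset.mem_filter.2 ⟨Finset.mem_univ _, h⟩)
  · refine (Finset.card_le_card (t := P.image r) fun v hv => ?_).trans Finset.card_image_le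
    obtain ⟨-, hv, hv'⟩ := Finset.mem_filter.1 hv
    rcases hcover v with h | ⟨l, hl, rfl⟩
    · by_contra h'
      exact hv (Finset.mem_sdiff.2 ⟨h, h'⟩)
    · by_cases hc : φ l ∈ P
      · obtain ⟨l', hl'⟩ := Finset.card_pos.1 (hfibre _ hc ▸ Nat.one_pos)
        exact absurd (Finset.mem_filter.1 hl').2 (hv' l' (Finset.mem_filter.1 hl').1)
      · have : l ∈ S'.filter fun l' => φ l' = φ l := by
          rw [hfibre' _ hc]
          simp [hl]
        exact absurd rfl (hv' l (Finset.mem_filter.1 this).1)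

end

section

open scoped Classical

variable {V : Type*}

/-- The weighted vertex sum at `v` where only the edges in `T` are taken into account. -/
noncomputable def partialSum (ω : V → ℝ) (f : Sym2 V → ℝ) (T : Finset (Sym2 V)) (v : V) : ℝ :=
  ω v + ∑ e ∈ T with v ∈ e, f e

/-- A labeling of the edges in `T ⊆ E` from the lists `L` by distinct labels such that the vertices
all of whose edges are labeled have distinct weighted sums. -/
structure IsPartialLabeling (ω : V → ℝ) (L : Sym2 V → Finset ℝ) (E T : Finset (Sym2 V))
    (f : Sym2 V → ℝ) : Prop where
  mem : ∀ e ∈ T, f e ∈ L e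
  injOn : Set.InjOn f T
  sum_ne : ∀ u w, u ≠ w → (∀ e ∈ E, u ∈ e → e ∈ T) → (∀ e ∈ E, w ∈ e → e ∈ T) →
    partialSum ω f T u ≠ partialSum ω f T w

section extend

variable {ι : Type*} {ω : V → ℝ} {L : Sym2 V → Finset ℝ} {T : Finset (Sym2 V)}
  {f : Sym2 V → ℝ} {g : ι → Sym2 V} {y : ι → ℝ}

theorem extend_of_mem (hT : ∀ i, g i ∉ T) {e : Sym2 V} (he : e ∈ T) :
    Function.extend g y f e = f e :=
  Function.extend_apply' _ _ _ fun ⟨i, hi⟩ => hT i (hi ▸ he)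

variable [Fintype ι]

theorem partialSum_extend (hg : g.Injective) (hT : ∀ i, g i ∉ T) (v : V) :
    partialSum ω (Function.extend g y f) (T ∪ Finset.univ.image g) v =
      partialSum ω f T v + ∑ i, if v ∈ g i then y i else 0 := by
  have hdisj : Disjoint T (Finset.univ.image g) := by
    rw [Finset.disjoint_right]
    intro e he
    obtain ⟨i, -, rfl⟩ := Finset.mem_image.1 he
    exact hT i
  rw [partialSum, partialSum, add_assoc, Finset.sum_filter, Finset.sum_union hdisj,
    Finset.sum_image hg.injOn, Finset.sum_filter]
  congr 2
  · exact Finset.sum_congr rfl fun e he => by rw [extend_of_mem hT he]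
  · exact Finset.sum_congr rfl fun i _ => by rw [hg.extend_apply]

theorem extend_mem (hg : g.Injective) (hT : ∀ i, g i ∉ T) (hf : ∀ e ∈ T, f e ∈ L e)
    (hy : ∀ i, y i ∈ L (g i)) :
    ∀ e ∈ T ∪ Finset.univ.image g, Function.extend g y f e ∈ L e := by
  intro e he
  rcases Finset.mem_union.1 he with he | he
  · rw [extend_of_mem hT he]
    exact hf e he
  · obtain ⟨i, -, rfl⟩ := Finset.mem_image.1 he
    rw [hg.extend_apply]
    exact hy i

theorem extend_injOn (hg : g.Injective) (hT : ∀ i, g i ∉ T) (hf : Set.InjOn f T)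
    (hy : y.Injective) (hyT : ∀ i, y i ∉ T.image f) :
    Set.InjOn (Function.extend g y f) (T ∪ Finset.univ.image g : Finset (Sym2 V)) := by
  intro e he e' he' h
  rw [Finset.mem_coe, Finset.mem_union, Finset.mem_image] at he he'
  rcases he with he | ⟨i, -, rfl⟩ <;> rcases he' with he' | ⟨j, -, rfl⟩
  · rw [extend_of_mem hT he, extend_of_mem hT he'] at h
    exact hf he he' h
  · rw [extend_of_mem hT he, hg.extend_apply] at h
    exact absurd (Finset.mem_image.2 ⟨e, he, h⟩) (hyT j)
  · rw [extend_of_mem hT he', hg.extend_apply] at h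
    exact absurd (Finset.mem_image.2 ⟨e', he', h.symm⟩) (hyT i)
  · rw [hg.extend_apply, hg.extend_apply] at h
    rw [hy h]

end extend

theorem Finset.card_sub_sub_le_card_sdiff_sdiff {α β γ : Type*} (A : Finset α) (B : Finset β)
    (C : Finset γ) (b : β → α) (c : γ → α) :
    A.card - B.card - C.card ≤ ((A \ B.image b) \ C.image c).card := by
  have h₁ := Finset.le_card_sdiff (B.image b) A
  have h₂ := Finset.le_card_sdiff (C.image c) (A \ B.image b)
  have h₃ := Finset.card_image_le (s := B) (f := b)
  have h₄ := Finset.card_image_le (s := C) (f := c)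
  omega

/-- A greedy labeling of `T` by distinct labels which separates the partial sums at
prescribed pairs of vertices. -/
theorem exists_greedy_labeling (ω : V → ℝ) {L : Sym2 V → Finset ℝ} {N : V → Finset V} {Δ : ℕ}
    (hN : ∀ u w, w ∈ N u → u ∈ N w) (hΔ : ∀ u, (N u).card ≤ Δ) (T : Finset (Sym2 V))
    (hT : ∀ v, s(v, v) ∉ T) (hL : ∀ e ∈ T, T.card + 2 * Δ ≤ (L e).card) :
    ∃ f : Sym2 V → ℝ, (∀ e ∈ T, f e ∈ L e) ∧ Set.InjOn f T ∧
      ∀ u w, w ∈ N u → (∃ e ∈ T, ¬(u ∈ e ↔ w ∈ e)) →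
        partialSum ω f T u ≠ partialSum ω f T w := by
  induction T using Finset.induction_on with
  | empty => exact ⟨fun _ => 0, by simp⟩
  | insert e T he ih =>
    rw [Finset.card_insert_of_notMem he] at hL
    obtain ⟨f, hmem, hinj, hsum⟩ := ih (fun v hv => hT v (Finset.mem_insert_of_mem hv))
      fun e he => (by have := hL e (Finset.mem_insert_of_mem he); omega)
    induction e using Sym2.ind with
    | _ a b =>
    have hab : a ≠ b := by
      rintro rfl
      exact hT a (Finset.mem_insert_self _ _)
    set σ := partialSum ω f T with hσ
    have h₁ := Finset.card_sub_sub_le_card_sdiff_sdiff (L s(a, b)) T (N a) f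
      fun v => σ v - σ a
    have h₂ := Finset.le_card_sdiff ((N b).image fun v => σ v - σ b)
      ((L s(a, b) \ T.image f) \ (N a).image fun v => σ v - σ a)
    have h₃ := Finset.card_image_le (s := N b) (f := fun v => σ v - σ b)
    have h₄ := hL s(a, b) (Finset.mem_insert_self _ _)
    have h₅ := hΔ a
    have h₆ := hΔ b
    obtain ⟨x, hx⟩ := Finset.card_pos.1 (lt_of_lt_of_le (by omega) h₂)
    simp only [Finset.mem_sdiff] at hx
    have hne : ∀ u ∈ s(a, b), ∀ w ∈ N u, σ u + x ≠ σ w := by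
      intro u hu w hw h
      rcases Sym2.mem_iff.1 hu with rfl | rfl
      · exact hx.1.2 (Finset.mem_image.2 ⟨w, hw, by linarith⟩)
      · exact hx.2 (Finset.mem_image.2 ⟨w, hw, by linarith⟩)
    have hg : Function.Injective fun _ : Unit => s(a, b) := fun _ _ _ => rfl
    have hT' : ∀ i : Unit, (fun _ : Unit => s(a, b)) i ∉ T := fun _ => he
    have hins : insert s(a, b) T = T ∪ Finset.univ.image fun _ : Unit => s(a, b) := by
      ext e; simp [or_comm]
    rw [hins]
    refine ⟨Function.extend (fun _ : Unit => s(a, b)) (fun _ => x) f,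
      extend_mem hg hT' hmem fun _ => hx.1.1.1,
      extend_injOn hg hT' hinj (fun _ _ _ => rfl) fun _ => hx.1.1.2, fun u w huw hsep => ?_⟩
    rw [partialSum_extend hg hT', partialSum_extend hg hT', Fintype.sum_unique,
      Fintype.sum_unique, ← hσ]
    have hold : (u ∈ s(a, b) ↔ w ∈ s(a, b)) → σ u ≠ σ w := by
      intro h
      obtain ⟨e, heT, hsep⟩ := hsep
      refine hsum u w huw ⟨e, ?_, hsep⟩
      rcases Finset.mem_union.1 heT with h' | h'
      · exact h'
      · obtain ⟨-, -, rfl⟩ := Finset.mem_image.1 h'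
        exact absurd h hsep
    by_cases hu : u ∈ s(a, b) <;> by_cases hw : w ∈ s(a, b) <;>
      simp only [hu, hw, if_true, if_false, add_zero]
    · exact fun h => hold (by simp only [hu, hw]) (add_right_cancel h)
    · exact hne u hu w huw
    · exact (hne w hw u (hN u w huw)).symm
    · exact hold (by simp only [hu, hw])

variable {ω : V → ℝ} {L : Sym2 V → Finset ℝ} {E T : Finset (Sym2 V)} {f : Sym2 V → ℝ}

/-- Labeling a set of pairwise disjoint edges. -/
theorem exists_isPartialLabeling_matching {ι : Type*} [Fintype ι] {p : ι → Bool → V}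
    {R : Finset V} (hp : (Function.uncurry p).Injective) (hpR : ∀ i b, p i b ∉ R)
    (hmem : ∀ e ∈ T, f e ∈ L e) (hinj : Set.InjOn f T)
    (hR : Set.InjOn (partialSum ω f T) R)
    (hpair : ∀ i, partialSum ω f T (p i true) ≠ partialSum ω f T (p i false))
    (he : ∀ i, s(p i true, p i false) ∉ T)
    (hsat : ∀ v, (∀ e ∈ E, v ∈ e → e ∈ T ∪ Finset.univ.image fun i => s(p i true, p i false)) →
      v ∈ R ∨ ∃ i b, v = p i b)
    (hL : ∀ i, T.card + 2 * R.card + 3 * (Fintype.card ι - 1) <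
      (L s(p i true, p i false)).card) :
    ∃ f', IsPartialLabeling ω L E
      (T ∪ Finset.univ.image fun i => s(p i true, p i false)) f' := by
  set σ := partialSum ω f T with hσ
  have hp' : ∀ {i j a b}, p i a = p j b ↔ i = j ∧ a = b := by
    intro i j a b
    exact ⟨fun h => Prod.mk.inj (hp (a₁ := (i, a)) (a₂ := (j, b)) h), by rintro ⟨rfl, rfl⟩; rfl⟩
  set X : ι → Finset ℝ := fun i =>
    ((L s(p i true, p i false) \ T.image f) \ R.image fun v => σ v - σ (p i true)) \
      R.image fun v => σ v - σ (p i false) with hX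
  have hXc : ∀ i, 3 * (Fintype.card ι - 1) < (X i).card := by
    intro i
    have h₁ := Finset.card_sub_sub_le_card_sdiff_sdiff (L s(p i true, p i false)) T R f
      fun v => σ v - σ (p i true)
    have h₂ := Finset.le_card_sdiff (R.image fun v => σ v - σ (p i false))
      ((L s(p i true, p i false) \ T.image f) \ R.image fun v => σ v - σ (p i true))
    have h₃ := Finset.card_image_le (s := R) (f := fun v => σ v - σ (p i false))
    have := hL i
    simp only [hX]
    omega
  let _ : LinearOrder ι := WellOrderingRel.isWellOrder.linearOrder
  obtain ⟨y, hy, hy'⟩ := exists_mem_sub_ne (κ := Option (Bool × Bool)) (by simp) X hXc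
    fun i j k => k.elim 0 fun ab => σ (p j ab.2) - σ (p i ab.1)
  have hyinj : y.Injective := by
    intro i j h
    by_contra hij
    rcases lt_or_gt_of_ne hij with hij | hij
    · exact hy' i j hij none (by simp [h])
    · exact hy' j i hij none (by simp [h])
  have hyne : ∀ i j a b, i ≠ j → σ (p i a) + y i ≠ σ (p j b) + y j := by
    intro i j a b hij h
    rcases lt_or_gt_of_ne hij with hij | hij
    · exact hy' i j hij (some (a, b)) (by simp; linarith)
    · exact hy' j i hij (some (b, a)) (by simp; linarith)
  have hyR : ∀ i b, ∀ v ∈ R, σ (p i b) + y i ≠ σ v := by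
    intro i b v hv h
    have h₁ := Finset.mem_sdiff.1 (hy i)
    cases b
    · exact h₁.2 (Finset.mem_image.2 ⟨v, hv, by linarith⟩)
    · exact (Finset.mem_sdiff.1 h₁.1).2 (Finset.mem_image.2 ⟨v, hv, by linarith⟩)
  have hyL := fun i => Finset.mem_sdiff.1 (Finset.mem_sdiff.1 (Finset.mem_sdiff.1 (hy i)).1).1
  have hg : Function.Injective fun i => s(p i true, p i false) := by
    intro i j h
    rcases Sym2.eq_iff.1 h with h | h
    · exact (hp'.1 h.1).1
    · exact (hp'.1 h.1).1
  have hsumR : ∀ v ∈ R, partialSum ω (Function.extend (fun i => s(p i true, p i false)) y f)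
      (T ∪ Finset.univ.image fun i => s(p i true, p i false)) v = σ v := by
    intro v hv
    have hv' : ∀ i b, v ≠ p i b := fun i b h => hpR i b (h ▸ hv)
    rw [partialSum_extend hg he]
    simp [hv', hσ]
  have hsump : ∀ i b, partialSum ω (Function.extend (fun i => s(p i true, p i false)) y f)
      (T ∪ Finset.univ.image fun i => s(p i true, p i false)) (p i b) = σ (p i b) + y i := by
    intro i b
    rw [partialSum_extend hg he]
    cases b <;> simp [hp', hσ]
  refine ⟨Function.extend (fun i => s(p i true, p i false)) y f,
    extend_mem hg he hmem fun i => (hyL i).1, extend_injOn hg he hinj hyinj fun i => (hyL i).2,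
    fun u w huw hu hw => ?_⟩
  rcases hsat u hu with hu | ⟨i, a, rfl⟩ <;> rcases hsat w hw with hw | ⟨j, b, rfl⟩
  · rw [hsumR u hu, hsumR w hw]
    exact fun h => huw (hR hu hw h)
  · rw [hsumR u hu, hsump]
    exact (hyR j b u hu).symm
  · rw [hsumR w hw, hsump]
    exact hyR i a w hw
  · rw [hsump, hsump]
    by_cases hij : i = j
    · subst hij
      intro h
      have h := add_right_cancel h
      cases a <;> cases b
      · exact huw rfl
      · exact hpair i h.symm
      · exact hpair i h
      · exact huw rfl
    · exact hyne i j a b hij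

variable [Fintype V]

/-- Labeling an edge `s(l, c)` while another edge at `c` stays unlabeled. -/
theorem IsPartialLabeling.exists_insert (hf : IsPartialLabeling ω L E T f) {l c : V}
    (he : s(l, c) ∉ T) (hc : ∃ e ∈ E, c ∈ e ∧ e ∉ insert s(l, c) T)
    (hL : T.card + Fintype.card V ≤ (L s(l, c)).card) :
    ∃ f', IsPartialLabeling ω L E (insert s(l, c) T) f' := by
  have hpos : 0 < Fintype.card V := Fintype.card_pos_iff.2 ⟨l⟩
  have hcard := Finset.card_sub_sub_le_card_sdiff_sdiff (L s(l, c)) T (Finset.univ.erase l) f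
    fun v => partialSum ω f T v - partialSum ω f T l
  rw [Finset.card_erase_of_mem (Finset.mem_univ _), Finset.card_univ] at hcard
  obtain ⟨x, hx⟩ := Finset.card_pos.1 (lt_of_lt_of_le (by omega) hcard)
  rw [Finset.mem_sdiff, Finset.mem_sdiff] at hx
  have hg : Function.Injective fun _ : Unit => s(l, c) := fun _ _ _ => rfl
  have hT : ∀ i : Unit, (fun _ : Unit => s(l, c)) i ∉ T := fun _ => he
  have hins : insert s(l, c) T = T ∪ Finset.univ.image fun _ : Unit => s(l, c) := by
    ext e; simp [or_comm]
  rw [hins] at hc ⊢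
  have hnc : ∀ u, (∀ e ∈ E, u ∈ e → e ∈ T ∪ Finset.univ.image fun _ : Unit => s(l, c)) →
      u ≠ c := by
    rintro u hu rfl
    obtain ⟨e, heE, hue, heT⟩ := hc
    exact heT (hu e heE hue)
  have hl : ∀ w, w ≠ l → w ≠ c → partialSum ω f T l + x ≠ partialSum ω f T w :=
    fun w hw _ h => hx.2 (Finset.mem_image.2 ⟨w, by simp [hw], by linarith⟩)
  refine ⟨Function.extend (fun _ : Unit => s(l, c)) (fun _ => x) f,
    extend_mem hg hT hf.mem fun _ => hx.1.1,
    extend_injOn hg hT hf.injOn (fun _ _ _ => rfl) fun _ => hx.1.2, fun u w huw hu hw => ?_⟩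
  have hsat : ∀ u, u ≠ l → u ≠ c →
      (∀ e ∈ E, u ∈ e → e ∈ T ∪ Finset.univ.image fun _ : Unit => s(l, c)) →
      ∀ e ∈ E, u ∈ e → e ∈ T := by
    intro u hul huc hu e heE hue
    rcases Finset.mem_union.1 (hu e heE hue) with h | h
    · exact h
    · obtain ⟨-, -, rfl⟩ := Finset.mem_image.1 h
      simp [hul, huc] at hue
  have huc := hnc u hu
  have hwc := hnc w hw
  rw [partialSum_extend hg hT, partialSum_extend hg hT]
  by_cases hul : u = l
  · subst hul
    simpa [huw.symm, hwc] using hl w huw.symm hwc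
  · by_cases hwl : w = l
    · subst hwl
      simpa [huw, huc] using (hl u huw huc).symm
    · simpa [hul, hwl, huc, hwc] using
        hf.sum_ne u w huw (hsat u hul huc hu) (hsat w hwl hwc hw)

/-- Labeling the three edges of a claw. -/
theorem IsPartialLabeling.exists_claw (hf : IsPartialLabeling ω L E T f) {l : Fin 3 → V} {c : V}
    (hl : l.Injective) (hlc : ∀ i, l i ≠ c) (he : ∀ i, s(l i, c) ∉ T)
    (hL : ∀ i, T.card + 3 + 4 * Fintype.card V / 3 ≤ (L s(l i, c)).card) :
    ∃ f', IsPartialLabeling ω L E (T ∪ Finset.univ.image fun i => s(l i, c)) f' := by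
  set Q : Finset V := insert c (Finset.univ.image l) with hQ
  have hQc : Q.card = 4 := by
    rw [hQ, Finset.card_insert_of_notMem (by simpa using hlc),
      Finset.card_image_of_injective _ hl]
    rfl
  have hQV := Finset.card_le_univ Q
  have hPc : (Qᶜ).card = Fintype.card V - 4 := by rw [Finset.card_compl, hQc]
  set σ := partialSum ω f T with hσ
  set X : Fin 3 → Finset ℝ := fun i =>
    (L s(l i, c) \ T.image f) \ (Qᶜ).image fun v => σ v - σ (l i) with hX
  have hXc : ∀ i, Fintype.card V / 3 + 7 ≤ (X i).card := by
    intro i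
    have := Finset.card_sub_sub_le_card_sdiff_sdiff (L s(l i, c)) T Qᶜ f fun v => σ v - σ (l i)
    have := hL i
    simp only [hX]
    omega
  have hP := Finset.card_image_le (s := Qᶜ) (f := fun v => σ v - σ c)
  obtain ⟨x, hx, y, hy, z, hz, hsum, hxy, hxz, hyz⟩ := exists_triple_sum_notMem
    (P := (Qᶜ).image fun v => σ v - σ c) (hXc 0) (hXc 1) (hXc 2) (by omega) (by omega)
    (σ (l 1) - σ (l 0)) (σ (l 2) - σ (l 0)) (σ (l 2) - σ (l 1))
    (σ (l 2) - σ c) (σ (l 1) - σ c) (σ (l 0) - σ c)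
  set t : Fin 3 → ℝ := ![x, y, z] with ht
  have htX : ∀ i, t i ∈ X i := by
    intro i; fin_cases i <;> simpa [ht]
  have htinj : t.Injective := by
    intro i j h
    fin_cases i <;> fin_cases j <;> simp_all
  have hg : Function.Injective fun i => s(l i, c) := fun i j h => hl (Sym2.congr_left.1 h)
  have hout : ∀ v, v ∉ Q → partialSum ω (Function.extend (fun i => s(l i, c)) t f)
      (T ∪ Finset.univ.image fun i => s(l i, c)) v = σ v := by
    intro v hv
    have hv' : ∀ i, v ∉ s(l i, c) := by
      intro i hi
      rcases Sym2.mem_iff.1 hi with rfl | rfl <;> simp [hQ] at hv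
    rw [partialSum_extend hg he]
    simp [hv', hσ]
  have hleaf : ∀ i, partialSum ω (Function.extend (fun i => s(l i, c)) t f)
      (T ∪ Finset.univ.image fun i => s(l i, c)) (l i) = σ (l i) + t i := by
    intro i
    rw [partialSum_extend hg he]
    simp [hlc, hl.eq_iff, hσ]
  have hcen : partialSum ω (Function.extend (fun i => s(l i, c)) t f)
      (T ∪ Finset.univ.image fun i => s(l i, c)) c = σ c + (x + y + z) := by
    rw [partialSum_extend hg he]
    simp [Fin.sum_univ_three, hσ, ht]
  refine ⟨Function.extend (fun i => s(l i, c)) t f, extend_mem hg he hf.mem fun i => ?_,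
    extend_injOn hg he hf.injOn htinj fun i => ?_, fun u w huw hu hw => ?_⟩
  · exact (Finset.mem_sdiff.1 (Finset.mem_sdiff.1 (htX i)).1).1
  · exact (Finset.mem_sdiff.1 (Finset.mem_sdiff.1 (htX i)).1).2
  have hcase : ∀ v, v ∉ Q ∨ v = c ∨ ∃ i, v = l i := by
    intro v
    by_cases hv : v ∈ Q
    · rw [hQ, Finset.mem_insert, Finset.mem_image] at hv
      rcases hv with hv | ⟨i, -, hv⟩
      · exact Or.inr (Or.inl hv)
      · exact Or.inr (Or.inr ⟨i, hv.symm⟩)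
    · exact Or.inl hv
  have hlo : ∀ i v, v ∉ Q → σ (l i) + t i ≠ σ v := fun i v hv h =>
    (Finset.mem_sdiff.1 (htX i)).2
      (Finset.mem_image.2 ⟨v, Finset.mem_compl.2 hv, by linarith⟩)
  have hco : ∀ v, v ∉ Q → σ c + (x + y + z) ≠ σ v := fun v hv h =>
    hsum (Finset.mem_image.2 ⟨v, Finset.mem_compl.2 hv, by linarith⟩)
  have hcl : ∀ i, σ (l i) + t i ≠ σ c + (x + y + z) := by
    intro i h
    fin_cases i <;> simp [ht] at h
    · exact hyz.2.2 (by linarith)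
    · exact hxz.2.2 (by linarith)
    · exact hxy.2.2 (by linarith)
  have hll : ∀ i j, i ≠ j → σ (l i) + t i ≠ σ (l j) + t j := by
    intro i j hij h
    fin_cases i <;> fin_cases j <;> simp [ht] at h hij
    · exact hxy.2.1 (by linarith)
    · exact hxz.2.1 (by linarith)
    · exact hxy.2.1 (by linarith)
    · exact hyz.2.1 (by linarith)
    · exact hxz.2.1 (by linarith)
    · exact hyz.2.1 (by linarith)
  have hsat : ∀ v, v ∉ Q → (∀ e ∈ E, v ∈ e → e ∈ T ∪ Finset.univ.image fun i => s(l i, c)) →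
      ∀ e ∈ E, v ∈ e → e ∈ T := by
    intro v hv h e heE hve
    rcases Finset.mem_union.1 (h e heE hve) with h | h
    · exact h
    · obtain ⟨i, -, rfl⟩ := Finset.mem_image.1 h
      rcases Sym2.mem_iff.1 hve with rfl | rfl <;> simp [hQ] at hv
  rcases hcase u with hu' | rfl | ⟨i, rfl⟩ <;> rcases hcase w with hw' | rfl | ⟨j, rfl⟩
  · rw [hout _ hu', hout _ hw']
    exact hf.sum_ne u w huw (hsat u hu' hu) (hsat w hw' hw)
  · rw [hout _ hu', hcen]
    exact (hco u hu').symm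
  · rw [hout _ hu', hleaf]
    exact (hlo j u hu').symm
  · rw [hout _ hw', hcen]
    exact hco w hw'
  · exact absurd rfl huw
  · rw [hcen, hleaf]
    exact (hcl j).symm
  · rw [hleaf, hout _ hw']
    exact hlo i w hw'
  · rw [hcen, hleaf]
    exact hcl i
  · rw [hleaf, hleaf]
    exact hll i j fun h => huw (by rw [h])

end

section

open scoped Classical

variable {V : Type*}

/-- The edges joining the vertices in `S` to their images under `φ`. -/
noncomputable def starEdges (S : Finset V) (φ : V → V) : Finset (Sym2 V) :=
  S.image fun l => s(l, φ l)

theorem mem_starEdges_iff {S : Finset V} {φ : V → V} (hS : ∀ l ∈ S, φ l ∉ S) {l : V} {A : Finset V}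
    (hA : A ⊆ S) (hl : l ∈ S) : s(l, φ l) ∈ starEdges A φ ↔ l ∈ A := by
  refine ⟨fun h => ?_, fun h => Finset.mem_image_of_mem _ h⟩
  obtain ⟨l', hl', h⟩ := Finset.mem_image.1 h
  rcases Sym2.eq_iff.1 h with h | h
  · exact h.1 ▸ hl'
  · exact absurd (h.1 ▸ hA hl') (hS l hl)

theorem card_starEdges {S : Finset V} {φ : V → V} (hS : ∀ l ∈ S, φ l ∉ S) :
    (starEdges S φ).card = S.card := by
  refine Finset.card_image_of_injOn fun l hl l' hl' h => ?_
  rcases Sym2.eq_iff.1 h with h | h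
  · exact h.1
  · exact absurd (h.1 ▸ hl) (hS l' hl')

variable [Fintype V] {ω : V → ℝ} {L : Sym2 V → Finset ℝ} {E : Finset (Sym2 V)}

theorem sdiff_starEdges_sdiff {S : Finset V} {φ : V → V} (hS : ∀ l ∈ S, φ l ∉ S)
    (hE : ∀ l ∈ S, s(l, φ l) ∈ E) {A : Finset V} (hA : A ⊆ S) :
    E \ starEdges (S \ A) φ = E \ starEdges S φ ∪ starEdges A φ := by
  ext e
  by_cases he : e ∈ starEdges S φ
  · obtain ⟨l, hl, rfl⟩ := Finset.mem_image.1 he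
    simp [mem_starEdges_iff hS, hA, hl, hE]
  · have h₁ : ∀ B ⊆ S, e ∉ starEdges B φ := fun B hB h => he (Finset.image_subset_image hB h)
    simp [h₁ A hA, h₁ (S \ A) Finset.sdiff_subset, he]

/-- Stars with at least three leaves can be labeled last. -/
theorem exists_isPartialLabeling_of_stars
    (hL : ∀ e ∈ E, E.card + 4 * Fintype.card V / 3 ≤ (L e).card) (S : Finset V) (φ : V → V)
    (hS : ∀ l ∈ S, φ l ∉ S) (hE : ∀ l ∈ S, s(l, φ l) ∈ E)
    (hfibre : ∀ l ∈ S, 3 ≤ (S.filter fun l' => φ l' = φ l).card)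
    (h : ∃ f, IsPartialLabeling ω L E (E \ starEdges S φ) f) :
    ∃ f, IsPartialLabeling ω L E E f := by
  induction S using Finset.strongInduction with
  | H S ih =>
  rcases S.eq_empty_or_nonempty with rfl | ⟨l, hl⟩
  · simpa [starEdges] using h
  obtain ⟨f, hf⟩ := h
  have hcardT : (E \ starEdges S φ).card + S.card = E.card := by
    rw [← card_starEdges hS]
    exact Finset.card_sdiff_add_card_eq_card
      (Finset.image_subset_iff.2 fun l hl => hE l hl)
  have hremove : ∀ A ⊆ S, A.Nonempty →
      (∀ l' ∈ S \ A, 3 ≤ ((S \ A).filter fun l'' => φ l'' = φ l').card) →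
      (∃ f, IsPartialLabeling ω L E (E \ starEdges S φ ∪ starEdges A φ) f) →
      ∃ f, IsPartialLabeling ω L E E f := by
    intro A hA hne hA' hf
    refine ih (S \ A) (Finset.sdiff_ssubset hA hne)
      (fun l hl h => hS l (Finset.sdiff_subset hl) (Finset.sdiff_subset h))
      (fun l hl => hE l (Finset.sdiff_subset hl)) hA' ?_
    rwa [sdiff_starEdges_sdiff hS hE hA]
  set F := S.filter fun l' => φ l' = φ l with hF
  have hlF : l ∈ F := Finset.mem_filter.2 ⟨hl, rfl⟩
  have hFS : F ⊆ S := Finset.filter_subset _ _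
  have hother : ∀ A ⊆ F, ∀ l', φ l' ≠ φ l →
      (S \ A).filter (fun l'' => φ l'' = φ l') = S.filter fun l'' => φ l'' = φ l' := by
    intro A hA l' hl'
    ext v
    simp only [Finset.mem_filter, Finset.mem_sdiff]
    exact ⟨fun h => ⟨h.1.1, h.2⟩, fun h => ⟨⟨h.1, fun hv =>
      hl' (h.2.symm.trans (Finset.mem_filter.1 (hA hv)).2)⟩, h.2⟩⟩
  have hFc : 3 ≤ F.card := hfibre l hl
  rcases hFc.lt_or_eq with h4 | h3
  · refine hremove {l} (by simpa using hl) (by simp) (fun l' hl' => ?_) ?_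
    · by_cases hc : φ l' = φ l
      · have h : F.erase l ⊆ (S \ {l}).filter fun l'' => φ l'' = φ l' := by
          intro v hv
          have hv' := Finset.mem_filter.1 (Finset.mem_erase.1 hv).2
          simp [(Finset.mem_erase.1 hv).1, hv'.1, hv'.2, hc]
        have := Finset.card_le_card h
        rw [Finset.card_erase_of_mem hlF] at this
        omega
      · rw [hother {l} (by simpa using hlF) l' hc]
        exact hfibre l' (Finset.sdiff_subset hl')
    · obtain ⟨l', hl', hne⟩ := Finset.exists_mem_ne (by omega : 1 < F.card) l
      have hl'' := Finset.mem_filter.1 hl'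
      have hT : s(l, φ l) ∉ E \ starEdges S φ := fun h =>
        (Finset.mem_sdiff.1 h).2 (Finset.mem_image_of_mem _ hl)
      have hSpos : 0 < S.card := Finset.card_pos.2 ⟨l, hl⟩
      have hLl := hL _ (hE l hl)
      obtain ⟨f', hf'⟩ := hf.exists_insert hT ⟨s(l', φ l'), hE l' hl''.1, by simp [hl''.2], by
        have h₁ : s(l', φ l') ∈ starEdges S φ := Finset.mem_image_of_mem _ hl''.1
        have h₂ : s(l', φ l') ≠ s(l, φ l) := by
          rw [hl''.2]
          exact fun h => hne (Sym2.congr_left.1 h)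
        simp [h₁, h₂]⟩ (by omega)
      refine ⟨f', ?_⟩
      convert hf' using 1
      ext e
      simp [starEdges]
  · refine hremove F hFS ⟨l, hlF⟩ (fun l' hl' => ?_) ?_
    · have hc : φ l' ≠ φ l := fun h => (Finset.mem_sdiff.1 hl').2
        (Finset.mem_filter.2 ⟨(Finset.mem_sdiff.1 hl').1, h⟩)
      rw [hother F subset_rfl l' hc]
      exact hfibre l' (Finset.sdiff_subset hl')
    · have e := (Finset.equivFinOfCardEq h3.symm).symm
      have hm : ∀ i, (e i : V) ∈ S ∧ φ (e i) = φ l := fun i => Finset.mem_filter.1 (e i).2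
      have hSF := Finset.card_le_card hFS
      obtain ⟨f', hf'⟩ := hf.exists_claw (l := fun i => (e i : V)) (c := φ l)
        (Subtype.val_injective.comp e.injective)
        (fun i h => hS l hl (h ▸ (hm i).1))
        (fun i h => (Finset.mem_sdiff.1 h).2
          (Finset.mem_image.2 ⟨e i, (hm i).1, by rw [(hm i).2]⟩))
        (fun i => by
          have := hL _ (hE _ (hm i).1)
          rw [(hm i).2] at this
          omega)
      refine ⟨f', ?_⟩
      convert hf' using 2
      ext d
      simp only [starEdges, Finset.mem_image, Finset.mem_univ, true_and]
      constructor
      · rintro ⟨v, hv, rfl⟩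
        exact ⟨e.symm ⟨v, hv⟩, by simp [(Finset.mem_filter.1 hv).2]⟩
      · rintro ⟨i, rfl⟩
        exact ⟨e i, (e i).2, by rw [(hm i).2]⟩

/-- If every vertex is covered by the finite set `E` of loopless edges and distinct vertices
have distinct sets of incident edges, then a complete labeling exists. -/
theorem exists_isPartialLabeling_self (hloop : ∀ v, s(v, v) ∉ E) (hcov : ∀ v, ∃ e ∈ E, v ∈ e)
    (hsep : ∀ u w, u ≠ w → ∃ e ∈ E, ¬(u ∈ e ↔ w ∈ e))
    (hL : ∀ e ∈ E, E.card + 4 * Fintype.card V / 3 ≤ (L e).card) :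
    ∃ f, IsPartialLabeling ω L E E f := by
  obtain ⟨S, φ, hS, hne2, hcard⟩ := exists_star_forest E hloop hcov
  set R := Finset.univ.filter fun v => v ∉ S ∧ ∀ l ∈ S, φ l ≠ v with hR
  set M := S.filter fun l => (S.filter fun l' => φ l' = φ l).card = 1 with hM
  have hS₁ : ∀ l ∈ S, φ l ∉ S := fun l hl => (hS l hl).1
  have hSE : ∀ l ∈ S, s(l, φ l) ∈ E := fun l hl => (hS l hl).2
  have hMS : M ⊆ S := Finset.filter_subset _ _
  have huniq : ∀ l ∈ M, ∀ l' ∈ S, φ l' = φ l → l' = l := by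
    intro l hl l' hl' h
    obtain ⟨hlS, h1⟩ := Finset.mem_filter.1 hl
    exact Finset.card_le_one.1 h1.le l' (by simp [hl', h]) l (by simp [hlS])
  have hRm : ∀ {v}, v ∈ R ↔ v ∉ S ∧ ∀ l ∈ S, φ l ≠ v := by simp [hR]
  have hn : 2 * M.card + R.card ≤ Fintype.card V := by
    have h₁ : Disjoint M (M.image φ) := by
      rw [Finset.disjoint_right]
      rintro v hv hv'
      obtain ⟨l, hl, rfl⟩ := Finset.mem_image.1 hv
      exact hS₁ l (hMS hl) (hMS hv')
    have h₂ : Disjoint (M ∪ M.image φ) R := by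
      rw [Finset.disjoint_right]
      intro v hv hv'
      rw [hRm] at hv
      rcases Finset.mem_union.1 hv' with h | h
      · exact hv.1 (hMS h)
      · obtain ⟨l, hl, h⟩ := Finset.mem_image.1 h
        exact hv.2 l (hMS hl) h
    have h₃ := Finset.card_le_univ ((M ∪ M.image φ) ∪ R)
    rw [Finset.card_union_of_disjoint h₂, Finset.card_union_of_disjoint h₁,
      Finset.card_image_of_injOn fun l hl l' hl' h => huniq l' hl' l (hMS hl) h] at h₃
    omega
  set T := E \ starEdges S φ with hT
  have hTc : T.card + S.card = E.card := by
    rw [← card_starEdges hS₁]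
    exact Finset.card_sdiff_add_card_eq_card (Finset.image_subset_iff.2 hSE)
  -- the pairs of vertices to be separated by the greedy labeling
  let N : V → Finset V := fun u => Finset.univ.filter fun w =>
    (u ≠ w ∧ u ∈ R ∧ w ∈ R) ∨ (u ∈ M ∧ w = φ u) ∨ (w ∈ M ∧ u = φ w)
  have hNm : ∀ {u w}, w ∈ N u ↔
      (u ≠ w ∧ u ∈ R ∧ w ∈ R) ∨ (u ∈ M ∧ w = φ u) ∨ (w ∈ M ∧ u = φ w) := by simp [N]
  have hNsymm : ∀ u w, w ∈ N u → u ∈ N w := by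
    intro u w h
    rw [hNm] at h ⊢
    rcases h with h | h | h
    · exact Or.inl ⟨h.1.symm, h.2.2, h.2.1⟩
    · exact Or.inr (Or.inr h)
    · exact Or.inr (Or.inl h)
  have hNc : ∀ u, (N u).card ≤ max 1 R.card := by
    intro u
    by_cases huR : u ∈ R
    · refine (Finset.card_le_card fun w hw => ?_).trans (le_max_right _ _)
      rw [hNm] at hw
      rcases hw with h | h | h
      · exact h.2.2
      · exact absurd (hMS h.1) (hRm.1 huR).1
      · exact absurd h.2.symm ((hRm.1 huR).2 w (hMS h.1))
    · refine (Finset.card_le_one.2 fun w hw w' hw' => ?_).trans (le_max_left _ _)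
      rw [hNm] at hw hw'
      replace hw := hw.resolve_left fun h => huR h.2.1
      replace hw' := hw'.resolve_left fun h => huR h.2.1
      rcases hw with h | h <;> rcases hw' with h' | h'
      · rw [h.2, h'.2]
      · exact absurd (h'.2 ▸ hMS h.1) (hS₁ w' (hMS h'.1))
      · exact absurd (h.2 ▸ hMS h'.1) (hS₁ w (hMS h.1))
      · exact huniq w' h'.1 w (hMS h.1) (h.2.symm.trans h'.2)
  have hV : ∀ e ∈ E, 2 ≤ Fintype.card V := by
    intro e he
    induction e using Sym2.ind with
    | _ a b =>
      have : a ≠ b := by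
        rintro rfl
        exact hloop a he
      exact Fintype.one_lt_card_iff.2 ⟨a, b, this⟩
  obtain ⟨f, hmem, hinj, hsum⟩ := exists_greedy_labeling (L := L) ω hNsymm hNc T
    (fun v hv => hloop v (Finset.sdiff_subset hv)) fun e he => by
      have h₁ := hL e (Finset.sdiff_subset he)
      have h₂ := hV e (Finset.sdiff_subset he)
      omega
  have hsum' : ∀ u w, w ∈ N u → partialSum ω f T u ≠ partialSum ω f T w := by
    intro u w huw
    refine hsum u w huw ?_
    have hne : u ≠ w := by
      rcases hNm.1 huw with h | h | h
      · exact h.1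
      · rintro rfl
        exact hS₁ u (hMS h.1) (h.2 ▸ hMS h.1)
      · rintro rfl
        exact hS₁ u (hMS h.1) (h.2 ▸ hMS h.1)
    obtain ⟨e, he, hue⟩ := hsep u w hne
    refine ⟨e, Finset.mem_sdiff.2 ⟨he, fun heS => hue ?_⟩, hue⟩
    obtain ⟨l, hl, rfl⟩ := Finset.mem_image.1 heS
    have hRl : ∀ v ∈ R, v ∉ s(l, φ l) := by
      intro v hv h
      rcases Sym2.mem_iff.1 h with rfl | rfl
      · exact (hRm.1 hv).1 hl
      · exact (hRm.1 hv).2 l hl rfl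
    have hMl : ∀ v ∈ M, (v ∈ s(l, φ l) ↔ φ v ∈ s(l, φ l)) := by
      intro v hv
      constructor <;> intro h <;> rcases Sym2.mem_iff.1 h with h | h
      · simp [h]
      · exact absurd (h ▸ hMS hv) (hS₁ l hl)
      · exact absurd (h ▸ hl) (hS₁ v (hMS hv))
      · simp [huniq v hv l hl h.symm]
    rcases hNm.1 huw with h | ⟨h, rfl⟩ | ⟨h, rfl⟩
    · simp [hRl u h.2.1, hRl w h.2.2]
    · exact hMl u h
    · exact (hMl w h).symm
  let p : M → Bool → V := fun l b => if b then l else φ l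
  have himage : (Finset.univ.image fun i : M => s(p i true, p i false)) = starEdges M φ := by
    ext e
    simp [p, starEdges]
  have hmatching := exists_isPartialLabeling_matching (E := E) (L := L) (ω := ω) (f := f) (T := T)
    (p := p) (R := R) ?_ ?_ hmem hinj ?_ ?_ ?_ ?_ ?_
  · rw [himage, hT, ← sdiff_starEdges_sdiff hS₁ hSE hMS] at hmatching
    refine exists_isPartialLabeling_of_stars hL (S \ M) φ
      (fun l hl h => hS₁ l (Finset.sdiff_subset hl) (Finset.sdiff_subset h))
      (fun l hl => hSE l (Finset.sdiff_subset hl)) (fun l hl => ?_) hmatching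
    obtain ⟨hlS, hlM⟩ := Finset.mem_sdiff.1 hl
    have h₁ : (S.filter fun l' => φ l' = φ l).card ≠ 1 := fun h =>
      hlM (Finset.mem_filter.2 ⟨hlS, h⟩)
    have h₂ := hne2 l hlS
    have h₃ : 0 < (S.filter fun l' => φ l' = φ l).card :=
      Finset.card_pos.2 ⟨l, by simp [hlS]⟩
    have h₄ : (S \ M).filter (fun l' => φ l' = φ l) = S.filter fun l' => φ l' = φ l := by
      ext l'
      simp only [Finset.mem_filter, Finset.mem_sdiff]
      refine ⟨fun h => ⟨h.1.1, h.2⟩, fun h => ⟨⟨h.1, fun hM' => hlM ?_⟩, h.2⟩⟩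
      rwa [huniq l' hM' l hlS h.2.symm]
    rw [h₄]
    omega
  · rintro ⟨⟨l, hl⟩, a⟩ ⟨⟨l', hl'⟩, b⟩ h
    have h₁ := hS₁ l (hMS hl)
    have h₂ := hS₁ l' (hMS hl')
    cases a <;> cases b <;> simp [p] at h
    · simp [huniq l' hl' l (hMS hl) h]
    · exact absurd (h ▸ hMS hl') h₁
    · exact absurd (h ▸ hMS hl) h₂
    · simp [h]
  · rintro ⟨l, hl⟩ b h
    rw [hRm] at h
    cases b
    · exact h.2 l (hMS hl) rfl
    · exact h.1 (hMS hl)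
  · intro u hu w hw h
    by_contra hne
    exact hsum' u w (hNm.2 (Or.inl ⟨hne, hu, hw⟩)) h
  · rintro ⟨l, hl⟩
    exact hsum' l (φ l) (hNm.2 (Or.inr (Or.inl ⟨hl, rfl⟩)))
  · rintro ⟨l, hl⟩ h
    exact (Finset.mem_sdiff.1 h).2 (Finset.mem_image_of_mem _ (hMS hl))
  · intro v hv
    rw [himage] at hv
    have hkey : ∀ l ∈ S, v ∈ s(l, φ l) → l ∈ M := by
      intro l hl hvl
      rcases Finset.mem_union.1 (hv _ (hSE l hl) hvl) with h | h
      · exact absurd (Finset.mem_image_of_mem _ hl) (Finset.mem_sdiff.1 h).2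
      · exact (mem_starEdges_iff hS₁ hMS hl).1 h
    by_cases hvR : v ∈ R
    · exact Or.inl hvR
    · right
      by_cases hvS : v ∈ S
      · exact ⟨⟨v, hkey v hvS (by simp)⟩, true, by simp [p]⟩
      · have : ∃ l ∈ S, φ l = v := by
          by_contra! h
          exact hvR (hRm.2 ⟨hvS, h⟩)
        obtain ⟨l, hl, rfl⟩ := this
        exact ⟨⟨l, hkey l hl (by simp)⟩, false, by simp [p]⟩
  · rintro ⟨l, hl⟩
    have h₁ := hL _ (hSE l (hMS hl))
    have h₂ := Finset.card_le_card hMS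
    have h₃ : 0 < M.card := Finset.card_pos.2 ⟨l, hl⟩
    simp only [p, if_true, Fintype.card_coe, Bool.false_eq_true, if_false]
    omega

end

open scoped Classical in
theorem weightedSum_eq_partialSum {V : Type*} [Fintype V] (G : SimpleGraph V) (ω : V → ℝ)
    (f : Sym2 V → ℝ) (v : V) :
    weightedSum G ω f v = partialSum ω f G.edgeSet.toFinite.toFinset v := by
  rw [weightedSum, partialSum]
  congr 1
  refine Finset.sum_congr ?_ fun _ _ => rfl
  ext e
  simp [SimpleGraph.incidenceSet]

theorem exists_edge_mem_not_iff {V : Type*} (G : SimpleGraph V) [Finite V]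
    (hK1 : ∀ v : V, 1 ≤ Nat.card (G.neighborSet v))
    (hK2 : ¬ ∃ u w : V, G.Adj u w ∧
      Nat.card (G.neighborSet u) = 1 ∧ Nat.card (G.neighborSet w) = 1) {u w : V} (huw : u ≠ w) :
    ∃ e ∈ G.edgeSet, ¬(u ∈ e ↔ w ∈ e) := by
  by_contra! h
  have key : ∀ u w, u ≠ w → (∀ e ∈ G.edgeSet, u ∈ e ↔ w ∈ e) → G.neighborSet u = {w} := by
    intro u w huw h
    have hsub : ∀ x ∈ G.neighborSet u, x = w := by
      intro x hx
      have := (h s(u, x) hx).1 (by simp)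
      rcases Sym2.mem_iff.1 this with h | h
      · exact absurd h.symm huw
      · exact h.symm
    obtain ⟨⟨x, hx⟩⟩ := (Nat.card_pos_iff.1 (hK1 u)).1
    refine Set.eq_singleton_iff_unique_mem.2 ⟨hsub x hx ▸ hx, hsub⟩
  have hu := key u w huw h
  have hw := key w u huw.symm fun e he => (h e he).symm
  refine hK2 ⟨u, w, ?_, by simp [hu], by simp [hw]⟩
  rw [← SimpleGraph.mem_neighborSet, hu]
  rfl

/-- Every graph on `n` vertices with no `K₁` component (i.e. no vertex of degree `0`)
and no `K₂` component (i.e. no pair of adjacent vertices both of degree `1`) is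
`⌊4n/3⌋`-weighted-list-antimagic. -/
theorem statement_0 {V : Type*} [Fintype V] (G : SimpleGraph V)
    (hK1 : ∀ v : V, 1 ≤ Nat.card (G.neighborSet v))
    (hK2 : ¬ ∃ u w : V, G.Adj u w ∧
      Nat.card (G.neighborSet u) = 1 ∧ Nat.card (G.neighborSet w) = 1) :
    ∀ (ω : V → ℝ) (L : Sym2 V → Finset ℝ),
      (∀ e ∈ G.edgeSet, Nat.card G.edgeSet + (4 * Fintype.card V) / 3 ≤ (L e).card) →
      ∃ f : Sym2 V → ℝ,
        (∀ e ∈ G.edgeSet, f e ∈ L e) ∧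
        (∀ e₁ ∈ G.edgeSet, ∀ e₂ ∈ G.edgeSet, e₁ ≠ e₂ → f e₁ ≠ f e₂) ∧
        (∀ u w : V, u ≠ w → weightedSum G ω f u ≠ weightedSum G ω f w) := by
  intro ω L hL
  have hcard : Nat.card G.edgeSet = G.edgeSet.toFinite.toFinset.card := by
    rw [Nat.card_coe_set_eq, Set.ncard_eq_toFinset_card _ G.edgeSet.toFinite]
  obtain ⟨f, hf⟩ := exists_isPartialLabeling_self (ω := ω) (L := L)
    (E := G.edgeSet.toFinite.toFinset) (fun v => by simp)
    (fun v => by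
      obtain ⟨⟨x, hx⟩⟩ := (Nat.card_pos_iff.1 (hK1 v)).1
      exact ⟨s(v, x), by simpa using hx, by simp⟩)
    (fun u w huw => by simpa using exists_edge_mem_not_iff G hK1 hK2 huw)
    (fun e he => by
      rw [← hcard]
      exact hL e (by simpa using he))
  refine ⟨f, fun e he => hf.mem e (by simpa using he),
    fun e he e' he' hne h => hne (hf.injOn (by simpa using he) (by simpa using he') h),
    fun u w huw => ?_⟩
  rw [weightedSum_eq_partialSum, weightedSum_eq_partialSum]
  exact hf.sum_ne u w huw (fun _ h _ => h) fun _ h _ => h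
end

section
/- Every graph on n vertices with no component isomorphic to K_1 (an isolated vertex) admits an orientation that is ⌊2n/3⌋-oriented-antimagic. -/
/-- `D` is an orientation of the simple graph `G`: a directed graph
whose underlying undirected graph is `G`. -/
def IsOrientation {V : Type*} (G : SimpleGraph V) (D : V → V → Prop) : Prop :=
  (∀ u w : V, G.Adj u w ↔ (D u w ∨ D w u)) ∧ (∀ u w : V, ¬(D u w ∧ D w u))

open Classical in
/-- The oriented vertex sum at `v`: the sum of the labels of edges oriented toward `v`
minus the sum of the labels of edges oriented away from `v`. -/
noncomputable def orientedSum {V : Type*} [Fintype V] (G : SimpleGraph V)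
    (D : V → V → Prop) (f : Sym2 V → ℕ) (v : V) : ℤ :=
  ∑ w ∈ (G.neighborSet v).toFinite.toFinset,
    if D w v then (f s(v, w) : ℤ) else -(f s(v, w) : ℤ)

section Arithmetic

lemma Finset.card_le_of_forall_mem_list {α : Type*} [DecidableEq α] (s : Finset α) (l : List α)
    (h : ∀ a ∈ s, a ∈ l) : s.card ≤ l.length :=
  (Finset.card_le_card fun a ha => List.mem_toFinset.2 (h a ha)).trans l.toFinset_card_le

/-- A difference set in `ℤ` has at least `|I| + |K| - 1` elements; here some of the differences
`y₀ - k` and `y - k₀` with the minima of `I` and `K` are allowed to lie outside `S`. -/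
lemma card_add_card_le_of_sub_mem {I K S : Finset ℤ} {y₀ k₀ : ℤ} {p q : ℕ}
    (hy₀ : ∀ y ∈ I, y₀ ≤ y) (hk₀ : ∀ k ∈ K, k₀ ≤ k)
    (hp : (K.filter fun k => y₀ - k ∉ S).card ≤ p)
    (hq : (I.filter fun y => y - k₀ ∉ S).card ≤ q) :
    I.card + K.card ≤ S.card + 1 + p + q := by
  have hK := Finset.card_filter_add_card_filter_not (s := K) (fun k => y₀ - k ∈ S)
  have hI := Finset.card_filter_add_card_filter_not (s := I) (fun y => y - k₀ ∈ S)
  set A := (K.filter fun k => y₀ - k ∈ S).image (fun k => y₀ - k) with hA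
  set B := (I.filter fun y => y - k₀ ∈ S).image (fun y => y - k₀) with hB
  have hAc : A.card = (K.filter fun k => y₀ - k ∈ S).card :=
    Finset.card_image_of_injective _ sub_right_injective
  have hBc : B.card = (I.filter fun y => y - k₀ ∈ S).card :=
    Finset.card_image_of_injective _ sub_left_injective
  have hunion : (A ∪ B).card ≤ S.card := by
    apply Finset.card_le_card
    intro s hs
    simp only [hA, hB, Finset.mem_union, Finset.mem_image, Finset.mem_filter] at hs
    rcases hs with ⟨k, hk, rfl⟩ | ⟨k, hk, rfl⟩ <;> exact hk.2
  have hinter : (A ∩ B).card ≤ 1 := by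
    refine Finset.card_le_of_forall_mem_list _ [y₀ - k₀] fun s hs => ?_
    simp only [hA, hB, Finset.mem_inter, Finset.mem_image, Finset.mem_filter] at hs
    obtain ⟨⟨k, hk, rfl⟩, y, hy, h⟩ := hs
    have := hk₀ k hk.1
    have := hy₀ y hy.1
    simp only [List.mem_singleton]
    omega
  have := Finset.card_union_add_card_inter A B
  omega

lemma card_le_card_filter_notMem_add_card {L S : Finset ℤ} {φ : ℤ → ℤ}
    (hφ : Function.Injective φ) : L.card ≤ (L.filter fun x => φ x ∉ S).card + S.card := by
  have h := Finset.card_filter_add_card_filter_not (s := L) (fun x => φ x ∈ S)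
  have : (L.filter fun x => φ x ∈ S).card ≤ S.card :=
    Finset.card_le_card_of_injOn φ (fun x hx => by simpa using (Finset.mem_filter.1 hx).2)
      hφ.injOn
  omega

lemma card_le_card_filter_notMem_list_add_length (L : Finset ℤ) (l : List ℤ) :
    L.card ≤ (L.filter fun x => x ∉ l).card + l.length := by
  have h := Finset.card_filter_add_card_filter_not (s := L) (fun x => x ∈ l)
  have : (L.filter fun x => x ∈ l).card ≤ l.length :=
    Finset.card_le_of_forall_mem_list _ l fun z hz => (Finset.mem_filter.1 hz).2
  omega

/-- Labels for the edges of a path on four vertices whose partial sums are `α, β, γ, δ`, such that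
the resulting sums are distinct and avoid `S`. -/
lemma exists_path_labels (L S : Finset ℤ) (α β γ δ : ℤ) (hL : 4 * S.card + 30 ≤ 3 * L.card) :
    ∃ x ∈ L, ∃ y ∈ L, ∃ z ∈ L, x.natAbs ≠ y.natAbs ∧ x.natAbs ≠ z.natAbs ∧ y.natAbs ≠ z.natAbs ∧
      α + x ∉ S ∧ β + y - x ∉ S ∧ γ - y + z ∉ S ∧ δ - z ∉ S ∧
      α + x ≠ β + y - x ∧ α + x ≠ γ - y + z ∧ α + x ≠ δ - z ∧
      β + y - x ≠ γ - y + z ∧ β + y - x ≠ δ - z ∧ γ - y + z ≠ δ - z := by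
  by_contra hno
  set X := L.filter fun x => α + x ∉ S with hX
  have hXc : L.card ≤ X.card + S.card :=
    card_le_card_filter_notMem_add_card (φ := fun x => α + x) (add_right_injective α)
  have hXne : X.Nonempty := Finset.card_pos.1 (by omega)
  obtain ⟨x₀, hx₀, hx₀min⟩ := X.exists_min_image id hXne
  simp only [id] at hx₀min
  set Z' := L.filter fun z => δ - z ∉ S with hZ'
  have hZ'c : L.card ≤ Z'.card + S.card :=
    card_le_card_filter_notMem_add_card (φ := fun z => δ - z) sub_right_injective
  set Z := Z'.filter fun z => z ∉ [x₀, -x₀, δ - α - x₀] with hZ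
  have hZc : Z'.card ≤ Z.card + 3 := card_le_card_filter_notMem_list_add_length _ _
  have hZne : Z.Nonempty := Finset.card_pos.1 (by omega)
  obtain ⟨z₀, hz₀, hz₀min⟩ := Z.exists_min_image id hZne
  simp only [id] at hz₀min
  -- the middle labels for which no label of the last edge is compatible with `x₀`
  let P : ℤ → ℤ → Prop := fun y z => y.natAbs ≠ z.natAbs ∧ γ - y + z ≠ δ - z ∧
    α + x₀ ≠ γ - y + z ∧ β + y - x₀ ≠ γ - y + z ∧ β + y - x₀ ≠ δ - z
  classical
  set I := L.filter fun y => ∀ z ∈ Z, P y z → γ - y + z ∈ S with hI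
  have hIc : I.card = 0 ∨ I.card + Z.card ≤ S.card + 1 + 6 + 6 := by
    rcases I.eq_empty_or_nonempty with h | h
    · simp [h]
    right
    obtain ⟨y₀, hy₀, hy₀min⟩ := I.exists_min_image id h
    have hS : S.card = (S.image fun s => γ - s).card :=
      (Finset.card_image_of_injective _ sub_right_injective).symm
    have hmem : ∀ y z, γ - y + z ∈ S → y - z ∈ S.image fun s => γ - s :=
      fun y z h => Finset.mem_image.2 ⟨_, h, by ring⟩
    rw [hS]
    apply card_add_card_le_of_sub_mem hy₀min hz₀min
    · refine Finset.card_le_of_forall_mem_list _ [y₀, -y₀, (δ - γ + y₀) / 2, α + x₀ - γ + y₀,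
        β + 2 * y₀ - x₀ - γ, δ - β - y₀ + x₀] fun z hz => ?_
      rw [Finset.mem_filter] at hz
      have h1 := mt ((Finset.mem_filter.1 hy₀).2 z hz.1) fun h => hz.2 (hmem _ _ h)
      simp only [List.mem_cons, List.not_mem_nil, or_false]
      by_contra hcon
      exact h1 ⟨by omega, by omega, by omega, by omega, by omega⟩
    · refine Finset.card_le_of_forall_mem_list _ [z₀, -z₀, γ + 2 * z₀ - δ, γ + z₀ - α - x₀,
        (γ + z₀ + x₀ - β) / 2, δ - z₀ - β + x₀] fun y hy => ?_
      rw [Finset.mem_filter] at hy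
      have h1 := mt ((Finset.mem_filter.1 hy.1).2 z₀ hz₀) fun h => hy.2 (hmem _ _ h)
      simp only [List.mem_cons, List.not_mem_nil, or_false]
      by_contra hcon
      exact h1 ⟨by omega, by omega, by omega, by omega, by omega⟩
  set J := L.filter fun y => ¬ ∀ z ∈ Z, P y z → γ - y + z ∈ S with hJ
  have hIJ : I.card + J.card = L.card := Finset.card_filter_add_card_filter_not _
  have hJne : J.Nonempty := Finset.card_pos.1 (by omega)
  have hJc : J.card + X.card ≤ S.card + 1 + 9 + 3 := by
    have hζ : ∀ y ∈ J, ∃ z ∈ Z, P y z ∧ γ - y + z ∉ S := by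
      intro y hy
      simpa using (Finset.mem_filter.1 hy).2
    choose! ζ hζZ hζP hζS using hζ
    obtain ⟨y₀, hy₀, hy₀min⟩ := J.exists_min_image id hJne
    have hS : S.card = (S.image fun s => s - β).card :=
      (Finset.card_image_of_injective _ sub_left_injective).symm
    have key : ∀ y ∈ J, ∀ x ∈ X, y - x ∉ (S.image fun s => s - β) →
        ¬ (x.natAbs ≠ y.natAbs ∧ x.natAbs ≠ (ζ y).natAbs ∧ α + x ≠ β + y - x ∧
          α + x ≠ γ - y + ζ y ∧ α + x ≠ δ - ζ y ∧ β + y - x ≠ γ - y + ζ y ∧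
          β + y - x ≠ δ - ζ y) := by
      rintro y hy x hx hxy ⟨h1, h2, h3, h4, h5, h6, h7⟩
      obtain ⟨p1, p2, -, -, -⟩ := hζP y hy
      have hz := Finset.mem_filter.1 (Finset.mem_filter.1 (hζZ y hy)).1
      refine hno ⟨x, (Finset.mem_filter.1 hx).1, y, (Finset.mem_filter.1 hy).1, ζ y, hz.1, h1, h2,
        p1, (Finset.mem_filter.1 hx).2, fun h => hxy (Finset.mem_image.2 ⟨_, h, by ring⟩),
        hζS y hy, hz.2, h3, h4, h5, h6, h7, p2⟩
    rw [hS]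
    apply card_add_card_le_of_sub_mem hy₀min hx₀min
    · refine Finset.card_le_of_forall_mem_list _ [y₀, -y₀, ζ y₀, - ζ y₀, (β + y₀ - α) / 2,
        γ - y₀ + ζ y₀ - α, δ - ζ y₀ - α, β + 2 * y₀ - γ - ζ y₀, β + y₀ - δ + ζ y₀] fun x hx => ?_
      rw [Finset.mem_filter] at hx
      simp only [List.mem_cons, List.not_mem_nil, or_false]
      by_contra hcon
      exact key y₀ hy₀ x hx.1 hx.2
        ⟨by omega, by omega, by omega, by omega, by omega, by omega, by omega⟩
    · refine Finset.card_le_of_forall_mem_list _ [x₀, -x₀, α + 2 * x₀ - β] fun y hy => ?_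
      rw [Finset.mem_filter] at hy
      have h3 := (Finset.mem_filter.1 (hζZ y hy.1)).2
      simp only [List.mem_cons, List.not_mem_nil, or_false] at h3 ⊢
      obtain ⟨-, -, p3, p4, p5⟩ := hζP y hy.1
      by_contra hcon
      exact key y hy.1 x₀ hx₀ hy.2 ⟨by omega, by omega, by omega, p3, by omega, p4, p5⟩
  omega

/-- Labels for the edges of a triangle such that the differences are distinct and avoid `S`. -/
lemma exists_triangle_labels (L S : Finset ℤ) (hsymm : ∀ x ∈ L, -x ∈ L)
    (hL : 4 * S.card + 26 ≤ 3 * L.card) :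
    ∃ x ∈ L, ∃ y ∈ L, ∃ z ∈ L, x.natAbs ≠ y.natAbs ∧ x.natAbs ≠ z.natAbs ∧ y.natAbs ≠ z.natAbs ∧
      x - y ∉ S ∧ y - z ∉ S ∧ z - x ∉ S ∧
      x - y ≠ y - z ∧ y - z ≠ z - x ∧ x - y ≠ z - x := by
  by_contra hno
  have hLne : L.Nonempty := Finset.card_pos.1 (by omega)
  obtain ⟨x, hx, hxmax⟩ := L.exists_max_image id hLne
  simp only [id] at hxmax
  set L' := L.filter fun y => y ∉ [x, -x] with hL'
  have hL'c : L.card ≤ L'.card + 2 := card_le_card_filter_notMem_list_add_length _ _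
  have hlt : ∀ y ∈ L', y < x ∧ -x < y := by
    intro y hy
    simp only [hL', Finset.mem_filter, List.mem_cons, List.not_mem_nil, or_false] at hy
    have := hxmax y hy.1
    have := hxmax _ (hsymm y hy.1)
    omega
  set Y := L'.filter fun y => x - y ∉ S with hY
  set Z := L'.filter fun z => z - x ∉ S with hZ
  have hYZ : 2 * L'.card ≤ Y.card + Z.card + S.card := by
    have h1 : (L'.filter fun y => x - y ∈ S).card + Y.card = L'.card :=
      Finset.card_filter_add_card_filter_not _
    have h2 : (L'.filter fun z => z - x ∈ S).card + Z.card = L'.card :=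
      Finset.card_filter_add_card_filter_not _
    have h3 := Finset.card_filter_add_card_filter_not (s := S) (fun s => 0 < s)
    have h4 : (L'.filter fun y => x - y ∈ S).card ≤ (S.filter fun s => 0 < s).card := by
      refine Finset.card_le_card_of_injOn (fun y => x - y) (fun y hy => ?_)
        sub_right_injective.injOn
      have hy' := Finset.mem_filter.1 hy
      have := hlt y hy'.1
      simp only [Finset.coe_filter, Set.mem_ofPred_eq]
      exact ⟨hy'.2, by omega⟩
    have h5 : (L'.filter fun z => z - x ∈ S).card ≤ (S.filter fun s => ¬ 0 < s).card := by
      refine Finset.card_le_card_of_injOn (fun z => z - x) (fun y hy => ?_)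
        sub_left_injective.injOn
      have hy' := Finset.mem_filter.1 hy
      have := hlt y hy'.1
      simp only [Finset.coe_filter, Set.mem_ofPred_eq]
      exact ⟨hy'.2, by omega⟩
    omega
  have hL'Y : Y.card ≤ L'.card := Finset.card_filter_le _ _
  have hL'Z : Z.card ≤ L'.card := Finset.card_filter_le _ _
  have hYc : L'.card ≤ Y.card + S.card :=
    card_le_card_filter_notMem_add_card (φ := fun y => x - y) sub_right_injective
  have hZc : L'.card ≤ Z.card + S.card :=
    card_le_card_filter_notMem_add_card (φ := fun z => z - x) sub_left_injective
  obtain ⟨y₀, hy₀, hy₀min⟩ := Y.exists_min_image id (Finset.card_pos.1 (by omega))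
  obtain ⟨z₀, hz₀, hz₀min⟩ := Z.exists_min_image id (Finset.card_pos.1 (by omega))
  have key : ∀ y ∈ Y, ∀ z ∈ Z, y - z ∉ S →
      ¬ (y.natAbs ≠ z.natAbs ∧ x - y ≠ y - z ∧ y - z ≠ z - x ∧ x - y ≠ z - x) := by
    rintro y hy z hz hyz ⟨h1, h2, h3, h4⟩
    have hy' := Finset.mem_filter.1 hy
    have hz' := Finset.mem_filter.1 hz
    have := hlt y hy'.1
    have := hlt z hz'.1
    exact hno ⟨x, hx, y, (Finset.mem_filter.1 hy'.1).1, z, (Finset.mem_filter.1 hz'.1).1, by omega,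
      by omega, h1, hy'.2, hyz, hz'.2, h2, h3, h4⟩
  have := card_add_card_le_of_sub_mem (p := 5) (q := 5) hy₀min hz₀min (S := S)
    (by
      refine Finset.card_le_of_forall_mem_list _ [y₀, -y₀, 2 * y₀ - x, (x + y₀) / 2, 2 * x - y₀]
        fun z hz => ?_
      rw [Finset.mem_filter] at hz
      have h1 := key y₀ hy₀ z hz.1 hz.2
      simp only [List.mem_cons, List.not_mem_nil, or_false]
      omega)
    (by
      refine Finset.card_le_of_forall_mem_list _ [z₀, -z₀, (x + z₀) / 2, 2 * z₀ - x, 2 * x - z₀]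
        fun y hy => ?_
      rw [Finset.mem_filter] at hy
      have h1 := key y hy.1 z₀ hz₀ hy.2
      simp only [List.mem_cons, List.not_mem_nil, or_false]
      omega)
  omega

end Arithmetic

section PartialLabeling

/-- A partial signed labeling of the edges of `G` with labels at most `M`: `g u v` is the label of
the edge `uv` if it is oriented from `u` to `v`, minus this label if it is oriented from `v` to `u`,
and `0` if the edge is not labeled. -/
structure IsPartialLabeling_s1 {V : Type*} (G : SimpleGraph V) (M : ℕ) (g : V → V → ℤ) : Prop where
  antisymm : ∀ u v, g v u = -g u v
  adj : ∀ u v, g u v ≠ 0 → G.Adj u v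
  le : ∀ u v, (g u v).natAbs ≤ M
  inj : ∀ u v u' v', g u v ≠ 0 → (g u v).natAbs = (g u' v').natAbs → s(u, v) = s(u', v')

/-- The label of an edge in a signed labeling. -/
noncomputable def edgeLabel {V : Type*} (g : V → V → ℤ) (e : Sym2 V) : ℕ :=
  (g (Quot.out e).1 (Quot.out e).2).natAbs

/-- The net flow into a vertex. -/
def inflow {V : Type*} [Fintype V] (g : V → V → ℤ) (v : V) : ℤ := ∑ w, g w v

open Classical in
/-- The signed labeling obtained from `g` by adding `t` to the flow from `v` to `u`. -/
noncomputable def addFlow {V : Type*} (g : V → V → ℤ) (u v : V) (t : ℤ) : V → V → ℤ :=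
  fun a b => g a b + (if b = u ∧ a = v then t else 0) - (if b = v ∧ a = u then t else 0)

open Classical in
/-- The labels that are not used. -/
noncomputable def freeLabels {V : Type*} (M : ℕ) (g : V → V → ℤ) : Finset ℕ :=
  (Finset.Icc 1 M).filter fun k => ∀ u v, (g u v).natAbs ≠ k

/-- The positive and negative unused labels. -/
noncomputable def signedFreeLabels {V : Type*} (M : ℕ) (g : V → V → ℤ) : Finset ℤ :=
  (freeLabels M g).image (fun k : ℕ => (k : ℤ)) ∪ (freeLabels M g).image (fun k : ℕ => -(k : ℤ))

variable {V : Type*}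

lemma mem_freeLabels {M : ℕ} {g : V → V → ℤ} {k : ℕ} :
    k ∈ freeLabels M g ↔ (1 ≤ k ∧ k ≤ M) ∧ ∀ u v, (g u v).natAbs ≠ k := by
  simp [freeLabels]

lemma mem_signedFreeLabels {M : ℕ} {g : V → V → ℤ} {t : ℤ} :
    t ∈ signedFreeLabels M g ↔ t.natAbs ∈ freeLabels M g := by
  simp only [signedFreeLabels, Finset.mem_union, Finset.mem_image]
  constructor
  · rintro (⟨k, hk, rfl⟩ | ⟨k, hk, rfl⟩) <;> simpa
  · intro h
    rcases Int.natAbs_eq t with h' | h'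
    · exact Or.inl ⟨_, h, h'.symm⟩
    · exact Or.inr ⟨_, h, h'.symm⟩

lemma card_signedFreeLabels (M : ℕ) (g : V → V → ℤ) :
    (signedFreeLabels M g).card = 2 * (freeLabels M g).card := by
  rw [signedFreeLabels, Finset.card_union_of_disjoint,
    Finset.card_image_of_injective _ Nat.cast_injective, Finset.card_image_of_injective, two_mul]
  · intro a b h
    simpa using h
  · rw [Finset.disjoint_left]
    simp only [Finset.mem_image, not_exists, not_and]
    rintro _ ⟨k, hk, rfl⟩ l hl h
    have := (mem_freeLabels.1 hk).1
    omega

lemma inflow_addFlow [Fintype V] (g : V → V → ℤ) (u v : V) (t : ℤ) (x : V) [Decidable (x = u)]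
    [Decidable (x = v)] :
    inflow (addFlow g u v t) x =
      inflow g x + (if x = u then t else 0) - (if x = v then t else 0) := by
  classical
  simp only [inflow, addFlow, Finset.sum_sub_distrib, Finset.sum_add_distrib, ite_and]
  congr 2
  · split_ifs <;> simp
  · split_ifs <;> simp

lemma addFlow_of_ne {g : V → V → ℤ} {u v a b : V} {t : ℤ} (h : s(a, b) ≠ s(u, v)) :
    addFlow g u v t a b = g a b := by
  have : ¬ (b = u ∧ a = v) := fun ⟨h1, h2⟩ => h (by rw [h1, h2, Sym2.eq_swap])
  have : ¬ (b = v ∧ a = u) := fun ⟨h1, h2⟩ => h (by rw [h1, h2])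
  simp [addFlow, *]

lemma addFlow_left {g : V → V → ℤ} {u v : V} {t : ℤ} (huv : u ≠ v) :
    addFlow g u v t u v = g u v - t := by
  simp [addFlow, huv, huv.symm]

lemma addFlow_right {g : V → V → ℤ} {u v : V} {t : ℤ} (huv : u ≠ v) :
    addFlow g u v t v u = g v u + t := by
  simp [addFlow, huv, huv.symm]

namespace IsPartialLabeling_s1

variable {G : SimpleGraph V} {M : ℕ} {g : V → V → ℤ}

lemma eq_zero_comm (hg : IsPartialLabeling_s1 G M g) {u v : V} : g u v = 0 ↔ g v u = 0 := by
  rw [hg.antisymm u v, neg_eq_zero]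

lemma eq_zero_of_sym2_eq (hg : IsPartialLabeling_s1 G M g) {u v a b : V} (h : s(u, v) = s(a, b))
    (h0 : g u v = 0) : g a b = 0 := by
  rcases Sym2.eq_iff.1 h with ⟨rfl, rfl⟩ | ⟨rfl, rfl⟩
  · exact h0
  · exact hg.eq_zero_comm.1 h0

lemma edgeLabel_mk (hg : IsPartialLabeling_s1 G M g) (u v : V) :
    edgeLabel g s(u, v) = (g u v).natAbs := by
  have h : s((Quot.out s(u, v)).1, (Quot.out s(u, v)).2) = s(u, v) := Quot.out_eq _
  rw [edgeLabel]
  rcases Sym2.eq_iff.1 h with ⟨h1, h2⟩ | ⟨h1, h2⟩ <;> rw [h1, h2]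
  rw [hg.antisymm u v, Int.natAbs_neg]

lemma addFlow (hg : IsPartialLabeling_s1 G M g) {u v : V} {t : ℤ} (huv : G.Adj u v)
    (h0 : g u v = 0) (ht : t.natAbs ∈ freeLabels M g) :
    IsPartialLabeling_s1 G M (addFlow g u v t) := by
  obtain ⟨⟨ht1, htM⟩, hfree⟩ := mem_freeLabels.1 ht
  have hne := huv.ne
  have h0' : g v u = 0 := hg.eq_zero_comm.1 h0
  have hcase : ∀ a b, (s(a, b) = s(u, v) ∧ (_root_.addFlow g u v t a b).natAbs = t.natAbs) ∨
      (s(a, b) ≠ s(u, v) ∧ _root_.addFlow g u v t a b = g a b) := by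
    intro a b
    by_cases h : s(a, b) = s(u, v)
    · left
      refine ⟨h, ?_⟩
      rcases Sym2.eq_iff.1 h with ⟨rfl, rfl⟩ | ⟨rfl, rfl⟩
      · rw [addFlow_left hne, h0]; omega
      · rw [addFlow_right hne, h0']; omega
    · exact Or.inr ⟨h, addFlow_of_ne h⟩
  refine ⟨fun a b => ?_, fun a b hab => ?_, fun a b => ?_, fun a b a' b' hab h => ?_⟩
  · by_cases h : s(a, b) = s(u, v)
    · rcases Sym2.eq_iff.1 h with ⟨rfl, rfl⟩ | ⟨rfl, rfl⟩
      · rw [addFlow_left hne, addFlow_right hne, h0, h0']; ring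
      · rw [addFlow_left hne, addFlow_right hne, h0, h0']; ring
    · rw [addFlow_of_ne h, addFlow_of_ne (by rwa [Sym2.eq_swap]), hg.antisymm]
  · rcases hcase a b with ⟨h, -⟩ | ⟨-, h⟩
    · rwa [← SimpleGraph.mem_edgeSet, h]
    · exact hg.adj a b (h ▸ hab)
  · rcases hcase a b with ⟨-, h⟩ | ⟨-, h⟩
    · rwa [h]
    · rw [h]
      exact hg.le a b
  · rcases hcase a b with ⟨h1, h2⟩ | ⟨h1, h2⟩ <;> rcases hcase a' b' with ⟨h3, h4⟩ | ⟨h3, h4⟩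
    · rw [h1, h3]
    · rw [h2, h4] at h
      exact absurd h.symm (hfree a' b')
    · rw [h2, h4] at h
      exact absurd h (hfree a b)
    · rw [h2] at hab
      rw [h2, h4] at h
      exact hg.inj a b a' b' hab h

lemma addFlow_ne_zero_iff (hg : IsPartialLabeling_s1 G M g) {u v : V} {t : ℤ} (huv : u ≠ v)
    (h0 : g u v = 0) (ht : t.natAbs ∈ freeLabels M g) (a b : V) :
    _root_.addFlow g u v t a b ≠ 0 ↔ g a b ≠ 0 ∨ s(a, b) = s(u, v) := by
  have h0' := hg.eq_zero_comm.1 h0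
  have ht0 := (mem_freeLabels.1 ht).1.1
  by_cases h : s(a, b) = s(u, v)
  · simp only [h, or_true, iff_true]
    rcases Sym2.eq_iff.1 h with ⟨rfl, rfl⟩ | ⟨rfl, rfl⟩
    · rw [addFlow_left huv, h0]; omega
    · rw [addFlow_right huv, h0']; omega
  · rw [addFlow_of_ne h]
    simp [h]

lemma mem_freeLabels_addFlow (hg : IsPartialLabeling_s1 G M g) {u v : V} {t : ℤ} (huv : u ≠ v)
    (h0 : g u v = 0) {k : ℕ} (hk : k ∈ freeLabels M g) (hkt : k ≠ t.natAbs) :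
    k ∈ freeLabels M (_root_.addFlow g u v t) := by
  have h0' := hg.eq_zero_comm.1 h0
  rw [mem_freeLabels] at hk ⊢
  refine ⟨hk.1, fun a b => ?_⟩
  by_cases h : s(a, b) = s(u, v)
  · rcases Sym2.eq_iff.1 h with ⟨rfl, rfl⟩ | ⟨rfl, rfl⟩
    · rw [addFlow_left huv, h0]; omega
    · rw [addFlow_right huv, h0']; omega
  · rw [addFlow_of_ne h]
    exact hk.2 a b

open Classical in
lemma card_freeLabels [Fintype V] (hg : IsPartialLabeling_s1 G M g) {F : Finset (Sym2 V)}
    (hF : F ⊆ G.edgeFinset) (h0 : ∀ u v, s(u, v) ∈ F → g u v = 0) :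
    M + F.card ≤ (freeLabels M g).card + G.edgeFinset.card := by
  have h1 : (Finset.Icc 1 M \ freeLabels M g).card ≤ (G.edgeFinset \ F).card := by
    refine (Finset.card_le_card ?_).trans (Finset.card_image_le (f := edgeLabel g))
    intro k hk
    simp only [Finset.mem_sdiff, Finset.mem_Icc, mem_freeLabels, not_and, not_forall,
      not_not] at hk
    obtain ⟨u, v, huv⟩ := hk.2 hk.1
    have hne : g u v ≠ 0 := by omega
    refine Finset.mem_image.2 ⟨s(u, v), ?_, by rw [hg.edgeLabel_mk, huv]⟩
    rw [Finset.mem_sdiff, SimpleGraph.mem_edgeFinset, SimpleGraph.mem_edgeSet]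
    exact ⟨hg.adj u v hne, fun h => hne (h0 u v h)⟩
  have h2 : freeLabels M g ⊆ Finset.Icc 1 M :=
    fun k hk => Finset.mem_Icc.2 (mem_freeLabels.1 hk).1
  have h3 := Finset.card_sdiff_add_card_eq_card h2
  have h4 := Finset.card_sdiff_add_card_eq_card hF
  rw [Nat.card_Icc] at h3
  omega

open Classical in
/-- A set of edges can be labeled with the edges at a given vertex `c` pointing away from `c`. -/
lemma exists_extension [Fintype V] (hg : IsPartialLabeling_s1 G M g) (hM : G.edgeFinset.card ≤ M)
    (c : V) (X : Finset (Sym2 V)) (hX : X ⊆ G.edgeFinset) :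
    ∃ g', IsPartialLabeling_s1 G M g' ∧ (∀ u v, g' u v ≠ 0 ↔ g u v ≠ 0 ∨ s(u, v) ∈ X) ∧
      (∀ u v, g u v ≠ 0 → g' u v = g u v) ∧ (∀ v, g v c = 0 → g' v c ≤ 0) := by
  induction X using Finset.induction_on with
  | empty => exact ⟨g, hg, by simp, fun _ _ _ => rfl, fun v hv => hv.le⟩
  | insert e X he ih =>
    obtain ⟨g₁, hg₁, hsupp, hext, hc⟩ := ih ((Finset.subset_insert _ _).trans hX)
    have heG : e ∈ G.edgeFinset := hX (Finset.mem_insert_self _ _)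
    by_cases hlab : ∃ u v, e = s(u, v) ∧ g u v ≠ 0
    · obtain ⟨u, v, rfl, huv⟩ := hlab
      refine ⟨g₁, hg₁, fun a b => ?_, hext, hc⟩
      rw [hsupp, Finset.mem_insert]
      constructor
      · tauto
      · rintro (h | h | h)
        · exact Or.inl h
        · exact Or.inl fun h0 => huv (hg.eq_zero_of_sym2_eq h h0)
        · exact Or.inr h
    push Not at hlab
    obtain ⟨u, v, rfl, huc⟩ : ∃ u v, e = s(u, v) ∧ u ≠ c := by
      induction e using Sym2.ind with
      | _ x y =>
        by_cases h : x = c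
        · refine ⟨y, x, Sym2.eq_swap, ?_⟩
          rw [SimpleGraph.mem_edgeFinset, SimpleGraph.mem_edgeSet] at heG
          exact fun h' => heG.ne (h.trans h'.symm)
        · exact ⟨x, y, rfl, h⟩
    rw [SimpleGraph.mem_edgeFinset, SimpleGraph.mem_edgeSet] at heG
    have hg0 : g u v = 0 := hlab u v rfl
    have hg₁0 : g₁ u v = 0 := by
      by_contra h
      rcases (hsupp u v).1 h with h | h
      · exact h hg0
      · exact he h
    have hfree := hg₁.card_freeLabels (F := {s(u, v)})
      (by simpa using heG)
      (fun a b hab => hg₁.eq_zero_of_sym2_eq (Finset.mem_singleton.1 hab).symm hg₁0)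
    rw [Finset.card_singleton] at hfree
    obtain ⟨k, hk⟩ : (freeLabels M g₁).Nonempty := Finset.card_pos.1 (by omega)
    have hk0 : 0 < k := (mem_freeLabels.1 hk).1.1
    refine ⟨_root_.addFlow g₁ u v k, hg₁.addFlow heG hg₁0 (by simpa using hk), fun a b => ?_,
      fun a b hab => ?_, fun w hw => ?_⟩
    · rw [hg₁.addFlow_ne_zero_iff heG.ne hg₁0 (by simpa using hk), hsupp, Finset.mem_insert]
      tauto
    · rw [addFlow_of_ne, hext a b hab]
      exact fun h => hab (hg.eq_zero_of_sym2_eq h.symm hg0)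
    · by_cases h : s(w, c) = s(u, v)
      · rcases Sym2.eq_iff.1 h with ⟨rfl, rfl⟩ | ⟨rfl, rfl⟩
        · rw [addFlow_left heG.ne, hg₁0]; omega
        · exact absurd rfl huc
      · rw [addFlow_of_ne h]
        exact hc w hw

end IsPartialLabeling_s1

end PartialLabeling

section Extension

open Classical

/-- All edges at the vertices of `U`, and no others, are labeled, and the sums at the vertices of
`U` are distinct. -/
structure IsCompleteOn {V : Type*} [Fintype V] (G : SimpleGraph V) (M : ℕ) (g : V → V → ℤ)
    (U : Finset V) : Prop where
  isPartialLabeling : IsPartialLabeling_s1 G M g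
  ne_zero_iff : ∀ u v, g u v ≠ 0 ↔ G.Adj u v ∧ (u ∈ U ∨ v ∈ U)
  injOn : Set.InjOn (inflow g) U

/-- No edge of `G` leaves `U`. -/
def IsAdjClosed {V : Type*} (G : SimpleGraph V) (U : Finset V) : Prop :=
  ∀ u v, G.Adj u v → u ∈ U → v ∈ U

variable {V : Type*} [Fintype V] {G : SimpleGraph V} {M : ℕ} {g : V → V → ℤ} {U : Finset V}

namespace IsCompleteOn

lemma eq_zero (h : IsCompleteOn G M g U) {u v : V} (hu : u ∉ U) (hv : v ∉ U) : g u v = 0 := by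
  by_contra h0
  rcases ((h.ne_zero_iff u v).1 h0).2 with h | h
  exacts [hu h, hv h]

/-- All edges at the vertices of `P` except those in `F` can be labeled. -/
lemma exists_extension (h : IsCompleteOn G M g U) (hM : G.edgeFinset.card ≤ M) (c : V)
    (P : Finset V) (F : Finset (Sym2 V)) (hF : ∀ u v, s(u, v) ∈ F → u ∉ U) :
    ∃ g', IsPartialLabeling_s1 G M g' ∧
      (∀ u v, g' u v ≠ 0 ↔ (G.Adj u v ∧ (u ∈ U ∪ P ∨ v ∈ U ∪ P)) ∧ s(u, v) ∉ F) ∧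
      (∀ u v, g u v ≠ 0 → g' u v = g u v) ∧ (∀ v, g v c = 0 → g' v c ≤ 0) ∧
      ∀ u ∈ U, inflow g' u = inflow g u := by
  obtain ⟨g', hg', hsupp, hext, hc⟩ := h.isPartialLabeling.exists_extension hM c
    (G.edgeFinset.filter fun e => e ∉ F ∧ ∃ v ∈ P, v ∈ e) (Finset.filter_subset _ _)
  refine ⟨g', hg', fun u v => ?_, hext, hc, fun u hu => ?_⟩
  · rw [hsupp, h.ne_zero_iff]
    have h1 := hF u v
    have h2 := hF v u
    rw [Sym2.eq_swap] at h2
    simp only [Finset.mem_filter, SimpleGraph.mem_edgeFinset, SimpleGraph.mem_edgeSet,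
      Sym2.mem_iff, Finset.mem_union]
    constructor
    · rintro (h3 | ⟨h3, h4, w, hw, rfl | rfl⟩) <;> tauto
    · rintro ⟨⟨h3, (h4 | h4) | (h4 | h4)⟩, h5⟩
      · exact Or.inl ⟨h3, Or.inl h4⟩
      · exact Or.inr ⟨h3, h5, u, h4, Or.inl rfl⟩
      · exact Or.inl ⟨h3, Or.inr h4⟩
      · exact Or.inr ⟨h3, h5, v, h4, Or.inr rfl⟩
  · refine Finset.sum_congr rfl fun w _ => ?_
    by_cases hw : g w u = 0
    · rw [hw]
      by_contra h0
      exact (h.ne_zero_iff w u).2 ⟨hg'.adj _ _ h0, Or.inr hu⟩ hw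
    · exact hext _ _ hw

/-- A vertex with a neighbor that is not yet treated can be added. -/
lemma exists_insert (h : IsCompleteOn G M g U)
    (hM : M = G.edgeFinset.card + 2 * Fintype.card V / 3) {v w : V} (hv : v ∉ U) (hw : w ∉ U)
    (hvw : G.Adj v w) : ∃ g', IsCompleteOn G M g' (insert v U) := by
  obtain ⟨g₁, hg₁, hsupp, -, -, hin⟩ := h.exists_extension (by omega) v {v} {s(v, w)} (by
    intro a b hab
    rcases Sym2.eq_iff.1 (Finset.mem_singleton.1 hab) with ⟨rfl, rfl⟩ | ⟨rfl, rfl⟩ <;> assumption)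
  have h0 : g₁ v w = 0 := by
    by_contra h0
    exact ((hsupp v w).1 h0).2 (Finset.mem_singleton_self _)
  have hfree := hg₁.card_freeLabels (F := {s(v, w)}) (by simpa using hvw)
    (fun a b hab => hg₁.eq_zero_of_sym2_eq (Finset.mem_singleton.1 hab).symm h0)
  have hcard : (insert v (insert w U)).card ≤ Fintype.card V := Finset.card_le_univ _
  rw [Finset.card_insert_of_notMem (by simp [hv, hvw.ne]), Finset.card_insert_of_notMem hw] at hcard
  obtain ⟨t, ht, htU⟩ : ∃ t ∈ signedFreeLabels M g₁,
      t ∉ U.image fun u => inflow g u - inflow g₁ v := by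
    apply Finset.exists_mem_notMem_of_card_lt_card
    have := Finset.card_image_le (s := U) (f := fun u => inflow g u - inflow g₁ v)
    rw [Finset.card_singleton] at hfree
    rw [card_signedFreeLabels]
    omega
  rw [mem_signedFreeLabels] at ht
  have hinU : ∀ u ∈ U, inflow (addFlow g₁ v w t) u = inflow g u := by
    intro u hu
    rw [inflow_addFlow, if_neg (by rintro rfl; exact hv hu), if_neg (by rintro rfl; exact hw hu),
      hin u hu]
    ring
  refine ⟨addFlow g₁ v w t, hg₁.addFlow hvw h0 ht, fun a b => ?_, ?_⟩
  · rw [hg₁.addFlow_ne_zero_iff hvw.ne h0 ht, hsupp, Finset.mem_singleton, Finset.union_singleton]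
    by_cases hab : s(a, b) = s(v, w)
    · rcases Sym2.eq_iff.1 hab with ⟨rfl, rfl⟩ | ⟨rfl, rfl⟩
      · simp [hvw]
      · simp [hvw.symm]
    · simp [hab]
  · rw [Finset.coe_insert, Set.injOn_insert (by simpa using hv)]
    refine ⟨fun a ha b hb hab => ?_, ?_⟩
    · rw [hinU a ha, hinU b hb] at hab
      exact h.injOn ha hb hab
    · rintro ⟨u, hu, huv⟩
      rw [hinU u hu, inflow_addFlow, if_pos rfl, if_neg hvw.ne] at huv
      exact htU (Finset.mem_image.2 ⟨u, hu, by linarith⟩)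

/-- Vertices can be added in an order in which each has a later neighbor. -/
lemma exists_union (h : IsCompleteOn G M g U)
    (hM : M = G.edgeFinset.card + 2 * Fintype.card V / 3) (d : V → ℕ) (Q : Finset V)
    (hQU : Disjoint Q U) (hQ : ∀ v ∈ Q, ∃ w ∉ U, G.Adj v w ∧ d w < d v) :
    ∃ g', IsCompleteOn G M g' (U ∪ Q) := by
  induction hn : Q.card generalizing Q U g with
  | zero =>
    rw [Finset.card_eq_zero] at hn
    exact ⟨g, by simpa [hn] using h⟩
  | succ n ih =>
    obtain ⟨v, hv, hvmax⟩ := Q.exists_max_image d (Finset.card_pos.1 (by omega))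
    obtain ⟨w, hw, hvw, -⟩ := hQ v hv
    have hvU := Finset.disjoint_left.1 hQU hv
    obtain ⟨g', hg'⟩ := h.exists_insert hM hvU hw hvw
    have := ih hg' (Q.erase v) ?_ ?_ (by rw [Finset.card_erase_of_mem hv]; omega)
    · rwa [Finset.insert_union, ← Finset.union_insert, Finset.insert_erase hv] at this
    · rw [Finset.disjoint_insert_right]
      exact ⟨Finset.notMem_erase _ _, hQU.mono_left (Finset.erase_subset _ _)⟩
    · intro x hx
      obtain ⟨y, hy, hxy, hd⟩ := hQ x (Finset.mem_of_mem_erase hx)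
      refine ⟨y, ?_, hxy, hd⟩
      rw [Finset.mem_insert, not_or]
      refine ⟨?_, hy⟩
      rintro rfl
      have := hvmax x (Finset.mem_of_mem_erase hx)
      omega

/-- A component that is a star can be added as long as all positive sums are labels and at most
half of the sums are not positive. -/
lemma exists_union_star (h : IsCompleteOn G M g U)
    (hM : M = G.edgeFinset.card + 2 * Fintype.card V / 3) (hU : IsAdjClosed G U)
    (hpos : ∀ u ∈ U, 0 < inflow g u → ∃ w, g w u = inflow g u)
    (hneg : 2 * (U.filter fun u => inflow g u ≤ 0).card ≤ U.card)
    {c l : V} (hc : c ∉ U) (hcl : G.Adj c l) (hstar : ∀ x y, G.Adj c x → G.Adj x y → y = c) :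
    ∃ g', ∃ U', U ⊂ U' ∧ IsCompleteOn G M g' U' ∧ IsAdjClosed G U' ∧
      (∀ u ∈ U', 0 < inflow g' u → ∃ w, g' w u = inflow g' u) ∧
      2 * (U'.filter fun u => inflow g' u ≤ 0).card ≤ U'.card := by
  have hNU : ∀ x, G.Adj c x → x ∉ U := fun x hx hxU => hc (hU x c hx.symm hxU)
  have hl := hNU l hcl
  obtain ⟨g₁, hg₁, hsupp, hext, hc₁, hin⟩ := h.exists_extension (by omega) c {c} {s(c, l)} (by
    intro a b hab
    rcases Sym2.eq_iff.1 (Finset.mem_singleton.1 hab) with ⟨rfl, rfl⟩ | ⟨rfl, rfl⟩ <;> assumption)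
  have h0 : g₁ c l = 0 := by
    by_contra h0
    exact ((hsupp c l).1 h0).2 (Finset.mem_singleton_self _)
  have h0' := hg₁.eq_zero_comm.1 h0
  have hfree := hg₁.card_freeLabels (F := {s(c, l)}) (by simpa using hcl)
    (fun a b hab => hg₁.eq_zero_of_sym2_eq (Finset.mem_singleton.1 hab).symm h0)
  have hcard : (insert c (insert l U)).card ≤ Fintype.card V := Finset.card_le_univ _
  rw [Finset.card_insert_of_notMem (by simp [hc, hcl.ne]), Finset.card_insert_of_notMem hl] at hcard
  obtain ⟨k, hk, hkU⟩ : ∃ k ∈ freeLabels M g₁, k ∉ (U.filter fun u => inflow g u ≤ 0).image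
      fun u => (inflow g₁ c - inflow g u).natAbs := by
    apply Finset.exists_mem_notMem_of_card_lt_card
    have := Finset.card_image_le (s := U.filter fun u => inflow g u ≤ 0)
      (f := fun u => (inflow g₁ c - inflow g u).natAbs)
    rw [Finset.card_singleton] at hfree
    omega
  have hk0 := (mem_freeLabels.1 hk).1.1
  set g₂ := addFlow g₁ l c k with hg₂def
  have hg₂ : IsPartialLabeling_s1 G M g₂ := hg₁.addFlow hcl.symm h0' (by simpa using hk)
  have hcin : inflow g₂ c = inflow g₁ c - k := by
    rw [inflow_addFlow, if_neg hcl.ne, if_pos rfl]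
    ring
  have hcneg : inflow g₁ c ≤ 0 := by
    refine Finset.sum_nonpos fun w _ => ?_
    by_cases hw : G.Adj c w
    · exact hc₁ w (h.eq_zero (hNU w hw) hc)
    · by_contra h0
      exact hw (hg₁.adj w c (by omega)).symm
  have hleaf : ∀ x, G.Adj c x → inflow g₂ x = g₂ c x ∧ 0 < g₂ c x := by
    intro x hx
    refine ⟨Finset.sum_eq_single c (fun y _ hy => ?_) (by simp), ?_⟩
    · by_contra h0
      exact hy (hstar x y hx (hg₂.adj y x h0).symm)
    · by_cases hxl : x = l
      · subst hxl
        rw [hg₂def, addFlow_right hcl.ne.symm, h0]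
        omega
      · have hne : s(c, x) ≠ s(c, l) := by
          intro h
          rcases Sym2.eq_iff.1 h with ⟨-, h⟩ | ⟨h, -⟩
          exacts [hxl h, hcl.ne h]
        rw [hg₂def, addFlow_of_ne (by rwa [Sym2.eq_swap (a := l)])]
        have h1 := hc₁ x (h.eq_zero (hNU x hx) hc)
        have h2 := (hsupp c x).2 ⟨⟨hx, Or.inl (by simp)⟩, by simpa using hne⟩
        have h3 := hg₁.antisymm c x
        omega
  have hinU : ∀ u ∈ U, inflow g₂ u = inflow g u := by
    intro u hu
    rw [inflow_addFlow, if_neg (by rintro rfl; exact hl hu), if_neg (by rintro rfl; exact hc hu),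
      hin u hu]
    ring
  have hposU : ∀ u ∈ U, 0 < inflow g u → ∃ w, g₂ w u = inflow g u := by
    intro u hu hlt
    obtain ⟨w, hw⟩ := hpos u hu hlt
    refine ⟨w, ?_⟩
    rw [hg₂def, addFlow_of_ne, hext w u (by omega), hw]
    intro hs
    rcases Sym2.eq_iff.1 hs with ⟨-, rfl⟩ | ⟨-, rfl⟩
    exacts [hc hu, hl hu]
  have hUc : ∀ u ∈ U, inflow g u ≠ inflow g₂ c := by
    intro u hu hEq
    refine hkU (Finset.mem_image.2 ⟨u, Finset.mem_filter.2 ⟨hu, by omega⟩, by omega⟩)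
  have hUleaf : ∀ u ∈ U, ∀ x, G.Adj c x → inflow g u ≠ inflow g₂ x := by
    intro u hu x hx hEq
    obtain ⟨h1, h2⟩ := hleaf x hx
    obtain ⟨w, hw⟩ := hposU u hu (by omega)
    have := hg₂.inj w u c x (by omega) (by omega)
    rcases Sym2.eq_iff.1 this with ⟨-, rfl⟩ | ⟨-, rfl⟩
    exacts [hNU u hx hu, hc hu]
  have hmem : ∀ u, u ∈ U ∪ insert c (G.neighborFinset c) ↔ u ∈ U ∨ u = c ∨ G.Adj c u := by
    simp [or_left_comm]
  refine ⟨g₂, U ∪ insert c (G.neighborFinset c), ?_, ⟨hg₂, fun a b => ?_, ?_⟩, ?_, ?_, ?_⟩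
  · rw [Finset.ssubset_iff_of_subset Finset.subset_union_left]
    exact ⟨c, by simp, hc⟩
  · rw [hg₁.addFlow_ne_zero_iff hcl.ne.symm h0' (by simpa using hk), hsupp,
      Finset.mem_singleton, Sym2.eq_swap (a := c)]
    simp only [hmem]
    by_cases hab : s(a, b) = s(l, c)
    · rcases Sym2.eq_iff.1 hab with ⟨rfl, rfl⟩ | ⟨rfl, rfl⟩
      · simp [hcl.symm]
      · simp [hcl]
    · rw [or_iff_left hab]
      simp only [hab, not_false_iff, and_true, Finset.mem_union, Finset.mem_singleton]
      constructor
      · tauto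
      · rintro ⟨hadj, (h1 | h1 | h1) | (h1 | h1 | h1)⟩
        · tauto
        · tauto
        · have := hstar a b h1 hadj
          tauto
        · tauto
        · tauto
        · have := hstar b a h1 hadj.symm
          tauto
  · intro u hu v hv huv
    rw [Finset.mem_coe, hmem] at hu hv
    rcases hu with hu | rfl | hu <;> rcases hv with hv | rfl | hv
    · rw [hinU u hu, hinU v hv] at huv
      exact h.injOn hu hv huv
    · rw [hinU u hu] at huv
      exact absurd huv (hUc u hu)
    · rw [hinU u hu] at huv
      exact absurd huv (hUleaf u hu v hv)
    · rw [hinU v hv] at huv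
      exact absurd huv.symm (hUc v hv)
    · rfl
    · have := hleaf v hv
      omega
    · rw [hinU v hv] at huv
      exact absurd huv.symm (hUleaf v hv u hu)
    · have := hleaf u hu
      omega
    · have h1 := hleaf u hu
      have h2 := hleaf v hv
      have := hg₂.inj c u c v (by omega) (by omega)
      rcases Sym2.eq_iff.1 this with ⟨-, h⟩ | ⟨rfl, -⟩
      exacts [h, absurd hv (G.irrefl)]
  · intro u v huv hu
    rw [hmem] at hu ⊢
    rcases hu with hu | rfl | hu
    · exact Or.inl (hU u v huv hu)
    · exact Or.inr (Or.inr huv)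
    · exact Or.inr (Or.inl (hstar u v hu huv))
  · intro u hu hlt
    rw [hmem] at hu
    rcases hu with hu | rfl | hu
    · rw [hinU u hu] at hlt ⊢
      exact hposU u hu hlt
    · omega
    · exact ⟨c, (hleaf u hu).1.symm⟩
  · have h1 : (U ∪ insert c (G.neighborFinset c)).filter (fun u => inflow g₂ u ≤ 0) ⊆
        insert c (U.filter fun u => inflow g u ≤ 0) := by
      intro u hu
      rw [Finset.mem_filter, hmem] at hu
      rcases hu with ⟨hu | rfl | hu, hle⟩
      · rw [hinU u hu] at hle
        exact Finset.mem_insert_of_mem (Finset.mem_filter.2 ⟨hu, hle⟩)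
      · exact Finset.mem_insert_self _ _
      · have := hleaf u hu
        omega
    have h2 := (Finset.card_le_card h1).trans (Finset.card_insert_le _ _)
    have h3 : insert c (insert l U) ⊆ U ∪ insert c (G.neighborFinset c) := by
      intro u hu
      rw [hmem]
      rcases Finset.mem_insert.1 hu with rfl | hu
      · tauto
      · rcases Finset.mem_insert.1 hu with rfl | hu <;> tauto
    have h4 := Finset.card_le_card h3
    rw [Finset.card_insert_of_notMem (by simp [hc, hcl.ne]),
      Finset.card_insert_of_notMem hl] at h4
    omega

/-- All edges at the vertices of `P` except three can be labeled, and then suitable labels of these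
three edges complete the labeling. -/
lemma exists_extension_of_three_edges (h : IsCompleteOn G M g U)
    (hM : M = G.edgeFinset.card + 2 * Fintype.card V / 3) {P : Finset V} (hPU : Disjoint P U)
    {a₁ b₁ a₂ b₂ a₃ b₃ : V} (h₁ : G.Adj a₁ b₁) (h₂ : G.Adj a₂ b₂) (h₃ : G.Adj a₃ b₃)
    (h₁P : a₁ ∈ P ∧ b₁ ∈ P) (h₂P : a₂ ∈ P ∧ b₂ ∈ P) (h₃P : a₃ ∈ P ∧ b₃ ∈ P)
    (h₁₂ : s(a₁, b₁) ≠ s(a₂, b₂)) (h₁₃ : s(a₁, b₁) ≠ s(a₃, b₃)) (h₂₃ : s(a₂, b₂) ≠ s(a₃, b₃)) :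
    ∃ g₁, (∀ u v, g₁ u v ≠ 0 → G.Adj u v ∧
        s(u, v) ≠ s(a₁, b₁) ∧ s(u, v) ≠ s(a₂, b₂) ∧ s(u, v) ≠ s(a₃, b₃)) ∧
      2 * (2 * Fintype.card V / 3) + 6 ≤ (signedFreeLabels M g₁).card ∧
      ∀ x ∈ signedFreeLabels M g₁, ∀ y ∈ signedFreeLabels M g₁, ∀ z ∈ signedFreeLabels M g₁,
        x.natAbs ≠ y.natAbs → x.natAbs ≠ z.natAbs → y.natAbs ≠ z.natAbs →
        Set.InjOn (inflow (addFlow (addFlow (addFlow g₁ a₁ b₁ x) a₂ b₂ y) a₃ b₃ z)) P →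
        (∀ v ∈ P, inflow (addFlow (addFlow (addFlow g₁ a₁ b₁ x) a₂ b₂ y) a₃ b₃ z) v ∉
          U.image (inflow g)) →
        ∃ g', IsCompleteOn G M g' (U ∪ P) := by
  have hP : ∀ v ∈ P, v ∉ U := fun v hv => Finset.disjoint_left.1 hPU hv
  obtain ⟨g₁, hg₁, hsupp, -, -, hin⟩ := h.exists_extension (by omega) a₁ P
    {s(a₁, b₁), s(a₂, b₂), s(a₃, b₃)} (by
      intro a b hab
      simp only [Finset.mem_insert, Finset.mem_singleton, Sym2.eq_iff] at hab
      rcases hab with (⟨rfl, rfl⟩ | ⟨rfl, rfl⟩) | (⟨rfl, rfl⟩ | ⟨rfl, rfl⟩) |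
        (⟨rfl, rfl⟩ | ⟨rfl, rfl⟩)
      exacts [hP _ h₁P.1, hP _ h₁P.2, hP _ h₂P.1, hP _ h₂P.2, hP _ h₃P.1, hP _ h₃P.2])
  have h0 : ∀ u v, s(u, v) ∈ ({s(a₁, b₁), s(a₂, b₂), s(a₃, b₃)} : Finset (Sym2 V)) →
      g₁ u v = 0 := by
    intro u v huv
    by_contra h0
    exact ((hsupp u v).1 h0).2 huv
  have h01 := h0 a₁ b₁ (by simp)
  have h02 := h0 a₂ b₂ (by simp)
  have h03 := h0 a₃ b₃ (by simp)
  refine ⟨g₁, fun u v huv => ?_, ?_, fun x hx y hy z hz hxy hxz hyz hinj hPin => ?_⟩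
  · simpa [not_or] using (⟨hg₁.adj u v huv, ((hsupp u v).1 huv).2⟩ : _ ∧ _)
  · have hfree := hg₁.card_freeLabels (F := {s(a₁, b₁), s(a₂, b₂), s(a₃, b₃)})
      (by
        intro e he
        simp only [Finset.mem_insert, Finset.mem_singleton] at he
        rw [SimpleGraph.mem_edgeFinset]
        rcases he with rfl | rfl | rfl <;> assumption) h0
    rw [Finset.card_eq_three.2 ⟨_, _, _, h₁₂, h₁₃, h₂₃, rfl⟩] at hfree
    rw [card_signedFreeLabels]
    omega
  · rw [mem_signedFreeLabels] at hx hy hz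
    have hg₂ := hg₁.addFlow h₁ h01 hx
    have h02' : addFlow g₁ a₁ b₁ x a₂ b₂ = 0 := by rw [addFlow_of_ne h₁₂.symm, h02]
    have hy' := hg₁.mem_freeLabels_addFlow h₁.ne h01 hy hxy.symm
    have hg₃ := hg₂.addFlow h₂ h02' hy'
    have h03' : addFlow (addFlow g₁ a₁ b₁ x) a₂ b₂ y a₃ b₃ = 0 := by
      rw [addFlow_of_ne h₂₃.symm, addFlow_of_ne h₁₃.symm, h03]
    have hz' := hg₂.mem_freeLabels_addFlow h₂.ne h02'
      (hg₁.mem_freeLabels_addFlow h₁.ne h01 hz hxz.symm) hyz.symm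
    have hg₄ := hg₃.addFlow h₃ h03' hz'
    have hinU : ∀ u ∈ U, inflow (addFlow (addFlow (addFlow g₁ a₁ b₁ x) a₂ b₂ y) a₃ b₃ z) u =
        inflow g u := by
      intro u hu
      have hne : ∀ v ∈ P, u ≠ v := fun v hv huv => hP v hv (huv ▸ hu)
      rw [inflow_addFlow, inflow_addFlow, inflow_addFlow, if_neg (hne _ h₁P.1),
        if_neg (hne _ h₁P.2), if_neg (hne _ h₂P.1), if_neg (hne _ h₂P.2), if_neg (hne _ h₃P.1),
        if_neg (hne _ h₃P.2), hin u hu]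
      ring
    refine ⟨_, hg₄, fun a b => ?_, ?_⟩
    · rw [hg₃.addFlow_ne_zero_iff h₃.ne h03' hz', hg₂.addFlow_ne_zero_iff h₂.ne h02' hy',
        hg₁.addFlow_ne_zero_iff h₁.ne h01 hx, hsupp]
      simp only [Finset.mem_insert, Finset.mem_singleton]
      have key : s(a, b) = s(a₁, b₁) ∨ s(a, b) = s(a₂, b₂) ∨ s(a, b) = s(a₃, b₃) →
          G.Adj a b ∧ (a ∈ U ∪ P ∨ b ∈ U ∪ P) := by
        simp only [Sym2.eq_iff, Finset.mem_union]
        rintro ((⟨rfl, rfl⟩ | ⟨rfl, rfl⟩) | (⟨rfl, rfl⟩ | ⟨rfl, rfl⟩) |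
          (⟨rfl, rfl⟩ | ⟨rfl, rfl⟩)) <;> simp [*, SimpleGraph.Adj.symm]
      tauto
    · intro u hu v hv huv
      rw [Finset.mem_coe, Finset.mem_union] at hu hv
      rcases hu with hu | hu <;> rcases hv with hv | hv
      · rw [hinU u hu, hinU v hv] at huv
        exact h.injOn hu hv huv
      · rw [hinU u hu] at huv
        exact absurd (Finset.mem_image.2 ⟨u, hu, huv⟩) (hPin v hv)
      · rw [hinU v hv] at huv
        exact absurd (Finset.mem_image.2 ⟨v, hv, huv.symm⟩) (hPin u hu)
      · exact hinj hu hv huv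

/-- The vertices of a path on four vertices can be added. -/
lemma exists_union_path (h : IsCompleteOn G M g U)
    (hM : M = G.edgeFinset.card + 2 * Fintype.card V / 3) {a b c d : V}
    (hPU : Disjoint {a, b, c, d} U) (hab : G.Adj a b) (hbc : G.Adj b c) (hcd : G.Adj c d)
    (hac : a ≠ c) (had : a ≠ d) (hbd : b ≠ d) :
    ∃ g', IsCompleteOn G M g' (U ∪ {a, b, c, d}) := by
  have nab := hab.ne
  have nbc := hbc.ne
  have ncd := hcd.ne
  obtain ⟨g₁, -, hcard, hext⟩ := h.exists_extension_of_three_edges hM hPU hab hbc hcd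
    (by simp) (by simp) (by simp)
    (by rw [Ne, Sym2.eq_iff]; tauto) (by rw [Ne, Sym2.eq_iff]; tauto)
    (by rw [Ne, Sym2.eq_iff]; tauto)
  have hPc : ({a, b, c, d} : Finset V).card = 4 := by
    rw [Finset.card_insert_of_notMem (by simp [nab, hac, had]),
      Finset.card_eq_three.2 ⟨b, c, d, nbc, hbd, ncd, rfl⟩]
  have hle := Finset.card_le_univ ({a, b, c, d} ∪ U)
  rw [Finset.card_union_of_disjoint hPU, hPc] at hle
  have himage := Finset.card_image_le (s := U) (f := inflow g)
  obtain ⟨x, hx, y, hy, z, hz, hxy, hxz, hyz, ha, hb, hc, hd, e1, e2, e3, e4, e5, e6⟩ :=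
    exists_path_labels (signedFreeLabels M g₁) (U.image (inflow g)) (inflow g₁ a) (inflow g₁ b)
      (inflow g₁ c) (inflow g₁ d) (by omega)
  set g₂ := addFlow (addFlow (addFlow g₁ a b x) b c y) c d z with hg₂
  have hsum_a : inflow g₂ a = inflow g₁ a + x := by simp [hg₂, inflow_addFlow, nab, hac, had]
  have hsum_b : inflow g₂ b = inflow g₁ b + y - x := by
    simp [hg₂, inflow_addFlow, nab.symm, nbc, hbd]; ring
  have hsum_c : inflow g₂ c = inflow g₁ c - y + z := by
    simp [hg₂, inflow_addFlow, nbc.symm, hac.symm, ncd]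
  have hsum_d : inflow g₂ d = inflow g₁ d - z := by
    simp [hg₂, inflow_addFlow, ncd.symm, hbd.symm, had.symm]
  rw [← hsum_a] at ha e1 e2 e3
  rw [← hsum_b] at hb e1 e4 e5
  rw [← hsum_c] at hc e2 e4 e6
  rw [← hsum_d] at hd e3 e5 e6
  refine hext x hx y hy z hz hxy hxz hyz ?_ ?_
  · change Set.InjOn (inflow g₂) _
    intro u hu v hv huv
    simp only [Finset.coe_insert, Finset.coe_singleton, Set.mem_insert_iff,
      Set.mem_singleton_iff] at hu hv
    rcases hu with rfl | rfl | rfl | rfl <;> rcases hv with rfl | rfl | rfl | rfl <;>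
      first | rfl | exact absurd huv (by assumption) | exact absurd huv.symm (by assumption)
  · change ∀ v ∈ _, inflow g₂ v ∉ _
    intro v hv
    simp only [Finset.mem_insert, Finset.mem_singleton] at hv
    rcases hv with rfl | rfl | rfl | rfl <;> assumption

/-- A component that is a triangle can be added. -/
lemma exists_union_triangle (h : IsCompleteOn G M g U)
    (hM : M = G.edgeFinset.card + 2 * Fintype.card V / 3) {u v w : V}
    (hPU : Disjoint {u, v, w} U) (huv : G.Adj u v) (huw : G.Adj u w) (hvw : G.Adj v w)
    (hu : ∀ x, G.Adj u x → x = v ∨ x = w) (hv : ∀ x, G.Adj v x → x = u ∨ x = w)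
    (hw : ∀ x, G.Adj w x → x = u ∨ x = v) :
    ∃ g', IsCompleteOn G M g' (U ∪ {u, v, w}) := by
  have nuv := huv.ne
  have nuw := huw.ne
  have nvw := hvw.ne
  obtain ⟨g₁, hsupp, hcard, hext⟩ := h.exists_extension_of_three_edges hM hPU huv huw.symm hvw
    (by simp) (by simp) (by simp)
    (by rw [Ne, Sym2.eq_iff]; tauto) (by rw [Ne, Sym2.eq_iff]; tauto)
    (by rw [Ne, Sym2.eq_iff]; tauto)
  have hPc : ({u, v, w} : Finset V).card = 3 := Finset.card_eq_three.2 ⟨u, v, w, nuv, nuw, nvw, rfl⟩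
  have hle := Finset.card_le_univ ({u, v, w} ∪ U)
  rw [Finset.card_union_of_disjoint hPU, hPc] at hle
  have himage := Finset.card_image_le (s := U) (f := inflow g)
  obtain ⟨x, hx, y, hy, z, hz, hxy, hxz, hyz, ha, hb, hc, e1, e2, e3⟩ :=
    exists_triangle_labels (signedFreeLabels M g₁) (U.image (inflow g))
      (fun x hx => by rw [mem_signedFreeLabels] at hx ⊢; simpa using hx) (by omega)
  set g₂ := addFlow (addFlow (addFlow g₁ u v x) w u y) v w z with hg₂
  have h0 : ∀ p q, (q = u ∨ q = v ∨ q = w) → g₁ p q = 0 := by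
    intro p q hq
    by_contra h0
    obtain ⟨hadj, h1, h2, h3⟩ := hsupp p q h0
    rcases hq with rfl | rfl | rfl
    · rcases hu p hadj.symm with rfl | rfl
      exacts [h1 Sym2.eq_swap, h2 rfl]
    · rcases hv p hadj.symm with rfl | rfl
      exacts [h1 rfl, h3 Sym2.eq_swap]
    · rcases hw p hadj.symm with rfl | rfl
      exacts [h2 Sym2.eq_swap, h3 rfl]
  have h0u : inflow g₁ u = 0 := Finset.sum_eq_zero fun p _ => h0 p u (by simp)
  have h0v : inflow g₁ v = 0 := Finset.sum_eq_zero fun p _ => h0 p v (by simp)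
  have h0w : inflow g₁ w = 0 := Finset.sum_eq_zero fun p _ => h0 p w (by simp)
  have iu : inflow g₂ u = x - y := by simp [hg₂, inflow_addFlow, nuv, nuw, h0u]
  have iv : inflow g₂ v = z - x := by
    simp [hg₂, inflow_addFlow, nuv.symm, nvw, h0v]; ring
  have iw : inflow g₂ w = y - z := by
    simp [hg₂, inflow_addFlow, nuw.symm, nvw.symm, h0w]
  rw [← iu] at ha e1 e3
  rw [← iw] at hb e1 e2
  rw [← iv] at hc e2 e3
  refine hext x hx y hy z hz hxy hxz hyz ?_ ?_
  · change Set.InjOn (inflow g₂) _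
    intro p hp q hq hpq
    simp only [Finset.coe_insert, Finset.coe_singleton, Set.mem_insert_iff,
      Set.mem_singleton_iff] at hp hq
    rcases hp with rfl | rfl | rfl <;> rcases hq with rfl | rfl | rfl <;>
      first | rfl | exact absurd hpq (by assumption) | exact absurd hpq.symm (by assumption)
  · change ∀ p ∈ _, inflow g₂ p ∉ _
    intro p hp
    simp only [Finset.mem_insert, Finset.mem_singleton] at hp
    rcases hp with rfl | rfl | rfl <;> assumption

/-- A component containing a path on four vertices can be added. -/
lemma exists_union_component (h : IsCompleteOn G M g U)
    (hM : M = G.edgeFinset.card + 2 * Fintype.card V / 3) (hU : IsAdjClosed G U) {a b c d : V}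
    (ha : a ∉ U) (hab : G.Adj a b) (hbc : G.Adj b c) (hcd : G.Adj c d)
    (hac : a ≠ c) (had : a ≠ d) (hbd : b ≠ d) :
    ∃ g', ∃ U', U ⊂ U' ∧ IsCompleteOn G M g' U' ∧ IsAdjClosed G U' := by
  have hout : ∀ u v, G.Adj u v → u ∉ U → v ∉ U := fun u v huv hu hv => hu (hU v u huv.symm hv)
  have hwalk : ∀ u v, G.Walk u v → u ∉ U → v ∉ U := by
    intro u v p
    induction p with
    | nil => exact id
    | cons huv _ ih => exact fun hu => ih (hout _ _ huv hu)
  have hreach : ∀ u, G.Reachable a u → u ∉ U := fun u ⟨p⟩ => hwalk a u p ha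
  set K := Finset.univ.filter fun u => G.Reachable a u with hK
  have hKmem : ∀ u, u ∈ K ↔ G.Reachable a u := by simp [hK]
  have hPK : ({a, b, c, d} : Finset V) ⊆ K := by
    intro u hu
    simp only [Finset.mem_insert, Finset.mem_singleton] at hu
    rw [hKmem]
    rcases hu with rfl | rfl | rfl | rfl
    exacts [.rfl, hab.reachable, hab.reachable.trans hbc.reachable,
      (hab.reachable.trans hbc.reachable).trans hcd.reachable]
  have hKU : Disjoint K U := Finset.disjoint_left.2 fun u hu => hreach u ((hKmem u).1 hu)
  obtain ⟨g₁, hg₁⟩ := h.exists_union hM (fun u => G.dist u a) (K \ {a, b, c, d})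
    (hKU.mono_left Finset.sdiff_subset) (by
      intro v hv
      rw [Finset.mem_sdiff, hKmem] at hv
      obtain ⟨p, hp⟩ := hv.1.symm.exists_walk_length_eq_dist
      cases p with
      | nil => exact absurd (by simp) hv.2
      | @cons _ w _ hvw q =>
        refine ⟨w, hout _ _ hvw (hreach v hv.1), hvw, ?_⟩
        have := SimpleGraph.dist_le q
        rw [SimpleGraph.Walk.length_cons] at hp
        omega)
  obtain ⟨g₂, hg₂⟩ := hg₁.exists_union_path hM
    (by
      rw [Finset.disjoint_union_right]
      exact ⟨hKU.mono_left hPK, Finset.disjoint_sdiff⟩) hab hbc hcd hac had hbd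
  rw [Finset.union_assoc, Finset.sdiff_union_of_subset hPK] at hg₂
  refine ⟨g₂, U ∪ K, ?_, hg₂, ?_⟩
  · rw [Finset.ssubset_iff_of_subset Finset.subset_union_left]
    exact ⟨a, by simp [hKmem], ha⟩
  · intro u v huv hu
    rw [Finset.mem_union, hKmem] at hu ⊢
    exact hu.imp (hU u v huv) fun hu => hu.trans huv.reachable

end IsCompleteOn

/-- The component of a vertex that is not isolated is a star or a triangle, or it contains a path on
four vertices. -/
lemma star_or_triangle_or_path {v w : V} (hvw : G.Adj v w) :
    (∃ c l, (c = v ∨ G.Adj v c) ∧ G.Adj c l ∧ ∀ x y, G.Adj c x → G.Adj x y → y = c) ∨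
    (∃ x y, G.Adj v x ∧ G.Adj v y ∧ G.Adj x y ∧ (∀ z, G.Adj v z → z = x ∨ z = y) ∧
      (∀ z, G.Adj x z → z = v ∨ z = y) ∧ ∀ z, G.Adj y z → z = v ∨ z = x) ∨
    ∃ a b c d, (a = v ∨ G.Adj v a) ∧ G.Adj a b ∧ G.Adj b c ∧ G.Adj c d ∧ a ≠ c ∧ a ≠ d ∧
      b ≠ d := by
  by_contra! hcon
  obtain ⟨hstar, htri, hpath⟩ := hcon
  obtain ⟨x, y, hvx, hxy, hyv⟩ := hstar v w (Or.inl rfl) hvw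
  by_cases hsingle : ∀ z, G.Adj v z → z = x
  · obtain ⟨p, q, hxp, hpq, hqx⟩ := hstar x v (Or.inr hvx) hvx.symm
    have hpv : p ≠ v := by
      rintro rfl
      exact hqx (hsingle q hpq)
    have hqv : q ≠ v := by
      rintro rfl
      exact hxp.ne (hsingle p hpq.symm).symm
    exact hqx.symm (hpath v x p q (Or.inl rfl) hvx hxp hpq hpv.symm hqv.symm)
  · push Not at hsingle
    obtain ⟨z, hvz, hzx⟩ := hsingle
    have hN : ∀ z, G.Adj v z → z = x ∨ z = y := by
      intro z hvz
      by_contra! hz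
      exact hyv.symm (hpath z v x y (Or.inr hvz) hvz.symm hvx hxy hz.1 hz.2)
    obtain rfl : z = y := (hN z hvz).resolve_left hzx
    obtain ⟨q, hzq, hqv, hqx⟩ := htri x z hvx hvz hxy hN (by
      intro q hxq
      by_contra! hq
      have := hpath z v x q (Or.inr hvz) hvz.symm hvx hxq hzx hq.2.symm
      exact hq.1.symm this)
    exact hqv.symm (hpath x v z q (Or.inr hvx) hvx.symm hvz hzq hzx.symm hqx.symm)

lemma exists_isCompleteOn_of_no_star
    (hM : M = G.edgeFinset.card + 2 * Fintype.card V / 3) :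
    ∃ g U, IsCompleteOn G M g U ∧ IsAdjClosed G U ∧
      ∀ c ∉ U, ∀ l, G.Adj c l → ¬ ∀ x y, G.Adj c x → G.Adj x y → y = c := by
  suffices H : ∀ n : ℕ, ∀ (g : V → V → ℤ) (U : Finset V), Uᶜ.card = n → IsCompleteOn G M g U →
      IsAdjClosed G U → (∀ u ∈ U, 0 < inflow g u → ∃ w, g w u = inflow g u) →
      2 * (U.filter fun u => inflow g u ≤ 0).card ≤ U.card →
      ∃ g U, IsCompleteOn G M g U ∧ IsAdjClosed G U ∧
        ∀ c ∉ U, ∀ l, G.Adj c l → ¬ ∀ x y, G.Adj c x → G.Adj x y → y = c by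
    refine H _ (fun _ _ => 0) ∅ rfl ⟨⟨?_, ?_, ?_, ?_⟩, ?_, ?_⟩ ?_ ?_ ?_ <;> simp [IsAdjClosed]
  intro n
  induction n using Nat.strong_induction_on with
  | _ n ih =>
    intro g U hn h hU hpos hneg
    by_cases hstar : ∀ c ∉ U, ∀ l, G.Adj c l → ¬ ∀ x y, G.Adj c x → G.Adj x y → y = c
    · exact ⟨g, U, h, hU, hstar⟩
    · push Not at hstar
      obtain ⟨c, hc, l, hcl, hs⟩ := hstar
      obtain ⟨g', U', hss, h', hU', hpos', hneg'⟩ := h.exists_union_star hM hU hpos hneg hc hcl hs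
      exact ih _ (hn ▸ Finset.card_lt_card (Finset.compl_ssubset_compl.2 hss)) g' U' rfl h' hU'
        hpos' hneg'

lemma IsCompleteOn.exists_univ (h : IsCompleteOn G M g U)
    (hM : M = G.edgeFinset.card + 2 * Fintype.card V / 3) (hU : IsAdjClosed G U)
    (hG : ∀ v, ∃ w, G.Adj v w)
    (hstar : ∀ c ∉ U, ∀ l, G.Adj c l → ¬ ∀ x y, G.Adj c x → G.Adj x y → y = c) :
    ∃ g', IsCompleteOn G M g' Finset.univ := by
  induction hn : Uᶜ.card using Nat.strong_induction_on generalizing U g with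
  | _ n ih =>
    by_cases hUuniv : U = Finset.univ
    · exact ⟨g, hUuniv ▸ h⟩
    obtain ⟨v, hv⟩ : ∃ v, v ∉ U := by
      by_contra! hall
      exact hUuniv (Finset.eq_univ_iff_forall.2 hall)
    have hout : ∀ u, G.Adj v u → u ∉ U := fun u huv hu => hv (hU u v huv.symm hu)
    have hout' : ∀ u, (u = v ∨ G.Adj v u) → u ∉ U := by
      rintro u (rfl | hu)
      exacts [hv, hout u hu]
    suffices H : ∃ g', ∃ U', U ⊂ U' ∧ IsCompleteOn G M g' U' ∧ IsAdjClosed G U' by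
      obtain ⟨g', U', hss, h', hU'⟩ := H
      exact ih _ (hn ▸ Finset.card_lt_card (Finset.compl_ssubset_compl.2 hss)) h' hU'
        (fun c hc => hstar c fun hcU => hc (hss.1 hcU)) rfl
    obtain ⟨w, hvw⟩ := hG v
    rcases star_or_triangle_or_path hvw with ⟨c, l, hc, hcl, hs⟩ |
      ⟨x, y, hvx, hvy, hxy, hNv, hNx, hNy⟩ | ⟨a, b, c, d, ha, hab, hbc, hcd, hac, had, hbd⟩
    · exact absurd hs (hstar c (hout' c hc) l hcl)
    · obtain ⟨g', hg'⟩ := h.exists_union_triangle hM (by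
        rw [Finset.disjoint_left]
        intro u hu
        simp only [Finset.mem_insert, Finset.mem_singleton] at hu
        rcases hu with rfl | rfl | rfl
        exacts [hv, hout _ hvx, hout _ hvy]) hvx hvy hxy hNv hNx hNy
      refine ⟨g', _, ?_, hg', ?_⟩
      · rw [Finset.ssubset_iff_of_subset Finset.subset_union_left]
        exact ⟨v, by simp, hv⟩
      · intro p q hpq hp
        simp only [Finset.mem_union, Finset.mem_insert, Finset.mem_singleton] at hp ⊢
        rcases hp with hp | rfl | rfl | rfl
        · exact Or.inl (hU p q hpq hp)
        · have := hNv q hpq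
          tauto
        · have := hNx q hpq
          tauto
        · have := hNy q hpq
          tauto
    · exact h.exists_union_component hM hU (hout' a ha) hab hbc hcd hac had hbd

lemma orientedSum_eq_inflow {g : V → V → ℤ} (hg : IsPartialLabeling_s1 G M g) (v : V) :
    orientedSum G (fun u w => 0 < g u w) (edgeLabel g) v = inflow g v := by
  rw [orientedSum, inflow]
  refine (Finset.sum_congr rfl fun w _ => (?_ : _ = g w v)).trans
    (Finset.sum_subset (Finset.subset_univ _) fun w _ hw => ?_)
  · rw [hg.edgeLabel_mk]
    have := hg.antisymm w v
    split_ifs <;> omega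
  · by_contra h0
    exact hw (by simpa using (hg.adj w v h0).symm)

end Extension

/-- Every graph on `n` vertices with no `K₁` component (i.e. no vertex of degree `0`)
admits an orientation that is `⌊2n/3⌋`-oriented-antimagic. -/
theorem statement_1 {V : Type*} [Fintype V] (G : SimpleGraph V)
    (hK1 : ∀ v : V, 1 ≤ Nat.card (G.neighborSet v)) :
    ∃ D : V → V → Prop, IsOrientation G D ∧
      ∃ f : Sym2 V → ℕ,
        (∀ e ∈ G.edgeSet,
          f e ∈ Finset.Icc 1 (Nat.card G.edgeSet + (2 * Fintype.card V) / 3)) ∧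
        (∀ e₁ ∈ G.edgeSet, ∀ e₂ ∈ G.edgeSet, e₁ ≠ e₂ → f e₁ ≠ f e₂) ∧
        (∀ u w : V, u ≠ w → orientedSum G D f u ≠ orientedSum G D f w) := by
  classical
  obtain ⟨g₀, U, h₀, hU, hstar⟩ := exists_isCompleteOn_of_no_star (G := G) rfl
  obtain ⟨g, hg⟩ := h₀.exists_univ rfl hU (fun v => by
    obtain ⟨⟨w, hw⟩⟩ := (Nat.card_pos_iff.1 (hK1 v)).1
    exact ⟨w, hw⟩) hstar
  have hpart := hg.isPartialLabeling
  have hne : ∀ u v, g u v ≠ 0 ↔ G.Adj u v := fun u v => by simpa using hg.ne_zero_iff u v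
  have hcard : Nat.card G.edgeSet = G.edgeFinset.card := by
    rw [Nat.card_eq_fintype_card, SimpleGraph.edgeFinset_card]
  refine ⟨fun u v => 0 < g u v, ⟨fun u v => ?_, fun u v => ?_⟩, edgeLabel g, fun e he => ?_,
    fun e₁ he₁ e₂ he₂ hne' hlab => ?_, fun u v huv hsum => ?_⟩
  · have := hpart.antisymm u v
    rw [← hne]
    omega
  · have := hpart.antisymm u v
    omega
  · induction e using Sym2.ind with
    | _ u v =>
      have h1 := (hne u v).2 he
      have h2 := hpart.le u v
      rw [hpart.edgeLabel_mk, Finset.mem_Icc, hcard]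
      omega
  · induction e₁ using Sym2.ind with
    | _ u v =>
      induction e₂ using Sym2.ind with
      | _ u' v' =>
        rw [hpart.edgeLabel_mk, hpart.edgeLabel_mk] at hlab
        exact hne' (hpart.inj u v u' v' ((hne u v).2 he₁) hlab)
  · rw [orientedSum_eq_inflow hpart, orientedSum_eq_inflow hpart] at hsum
    exact huv (hg.injOn (by simp) (by simp) hsum)
end
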